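/- Let f ∈ H²(𝔹), let I, J ∈ 𝕊 with J orthogonal to I, and let F, G : 𝔹_I → L_I be holomorphic functions such that f_I(z) = F(z) + G(z)J for all z ∈ 𝔹_I. Then f is inner if and only if for Lebesgue-almost every z ∈ ∂𝔹_I the following two conditions hold: |F(z)|² + |G(z)|² = 1 and F(z)G(conj z) = F(conj z)G(z). -/

import Mathlib

open MeasureTheory Filter Topology
open scoped ENNReal Classical

noncomputable section

/-! ### Basic quaternionic notions -/

instance : MeasurableSpace (Quaternion ℝ) := borel _
instance : BorelSpace (Quaternion ℝ) := ⟨rfl⟩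

/-- The 2-sphere `𝕊` of quaternionic imaginary units. -/
def USphere : Set (Quaternion ℝ) := {q | q ^ 2 = -1}

/-- The open quaternionic unit ball `𝔹`. -/
def QBall : Set (Quaternion ℝ) := {q | ‖q‖ < 1}

/-- The slice `L_I = ℝ + ℝI` through an imaginary unit `I`. -/
def sliceSet (I : Quaternion ℝ) : Set (Quaternion ℝ) :=
  {q | ∃ x y : ℝ, q = (x : Quaternion ℝ) + y • I}

/-- The point `e^{tI} = cos t + (sin t) I` of the boundary circle `∂𝔹_I`. -/
def ptOn (I : Quaternion ℝ) (t : ℝ) : Quaternion ℝ :=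
  ((Real.cos t : ℝ) : Quaternion ℝ) + Real.sin t • I

/-- Slice regularity on the unit ball: on every slice the restriction of `f` has partial
derivatives satisfying the Cauchy–Riemann equation `∂f/∂x + I ∂f/∂y = 0`. -/
def SliceRegular (f : Quaternion ℝ → Quaternion ℝ) : Prop :=
  ∀ I ∈ USphere, ∀ x y : ℝ, ((x : Quaternion ℝ) + y • I) ∈ QBall →
    ∃ fx fy : Quaternion ℝ,
      HasDerivAt (fun s : ℝ => f ((s : Quaternion ℝ) + y • I)) fx x ∧
      HasDerivAt (fun t : ℝ => f ((x : Quaternion ℝ) + t • I)) fy y ∧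
      fx + I * fy = 0

/-! ### The Hardy space `H²(𝔹)` via power series coefficients.
A slice regular function on `𝔹` is identified with its coefficient sequence
`a : ℕ → ℍ`, the function being `q ↦ ∑ qⁿ aₙ`. -/

/-- Membership in `H²(𝔹)`: square-summable coefficients. -/
def MemH2 (a : ℕ → Quaternion ℝ) : Prop := Summable (fun n => ‖a n‖ ^ 2)

/-- Evaluation of the power series `q ↦ ∑ qⁿ aₙ`. -/
def evalS (a : ℕ → Quaternion ℝ) (q : Quaternion ℝ) : Quaternion ℝ := ∑' n, q ^ n * a n

/-- The `*`-product (slice product) on coefficient sequences. -/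
def sProd (a b : ℕ → Quaternion ℝ) : ℕ → Quaternion ℝ :=
  fun n => ∑ k ∈ Finset.range (n + 1), a k * b (n - k)

/-- The regular conjugate `fᶜ`. -/
def conjS (a : ℕ → Quaternion ℝ) : ℕ → Quaternion ℝ := fun n => star (a n)

/-- The symmetrization `fˢ = f * fᶜ`. -/
def symmS (a : ℕ → Quaternion ℝ) : ℕ → Quaternion ℝ := sProd a (conjS a)

/-- The squared `H²` norm `∑ ‖aₙ‖²`. -/
def h2normSq (a : ℕ → Quaternion ℝ) : ℝ := ∑' n, ‖a n‖ ^ 2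

/-- The `H²` norm. -/
def h2norm (a : ℕ → Quaternion ℝ) : ℝ := Real.sqrt (h2normSq a)

/-- The (right) quaternionic inner product `⟨f,g⟩ = ∑ conj(bₙ) aₙ` of `H²(𝔹)`. -/
def h2inner (a b : ℕ → Quaternion ℝ) : Quaternion ℝ := ∑' n, star (b n) * a n

/-- Squared `H²`-distance of two coefficient sequences (valued in `ℝ≥0∞`). -/
def h2distSq (a b : ℕ → Quaternion ℝ) : ℝ≥0∞ := ∑' n, (‖a n - b n‖₊ : ℝ≥0∞) ^ 2

/-- The boundary value function of `f ∈ H²(𝔹)`, given by the radial limit where it exists. -/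
def bdval (a : ℕ → Quaternion ℝ) (q : Quaternion ℝ) : Quaternion ℝ :=
  if h : ∃ L, Tendsto (fun r : ℝ => evalS a ((r : Quaternion ℝ) * q)) (𝓝[<] (1 : ℝ)) (𝓝 L)
  then h.choose else 0

/-! ### The measure `Σ` on `∂𝔹` with `dΣ(e^{tI}) = dσ(I) dt`. -/

/-- The normalized area measure `σ` on the sphere `𝕊` of imaginary units
(2-dimensional Hausdorff measure, normalized so that `σ(𝕊) = 1`). -/
def sphMeasure : Measure (Quaternion ℝ) := (μH[2] USphere)⁻¹ • (μH[2]).restrict USphere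

/-- The measure `Σ` on `∂𝔹`, `dΣ(e^{tI}) = dσ(I) dt`, normalized so `Σ(∂𝔹) = 1`. -/
def SigmaBd : Measure (Quaternion ℝ) :=
  (ENNReal.ofReal (2 * Real.pi))⁻¹ •
    Measure.map (fun p : ℝ × Quaternion ℝ => ptOn p.2 p.1)
      ((volume.restrict (Set.Ico 0 (2 * Real.pi))).prod sphMeasure)

/-! ### Inner, outer, cyclic -/

/-- `f ∈ H^∞(𝔹)`: a bounded function of `H²(𝔹)`. -/
def MemHinf (a : ℕ → Quaternion ℝ) : Prop :=
  MemH2 a ∧ ∃ C : ℝ, ∀ q ∈ QBall, ‖evalS a q‖ ≤ C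

/-- The `H^∞` norm: the sup of `‖f‖` on the ball. -/
def hInfNorm (a : ℕ → Quaternion ℝ) : ℝ := sSup ((fun q => ‖evalS a q‖) '' QBall)

/-- `f` is inner: `f ∈ H^∞(𝔹)`, `‖f‖ ≤ 1` on `𝔹` and `‖f‖ = 1` `Σ`-a.e. on `∂𝔹`. -/
def IsInnerQ (a : ℕ → Quaternion ℝ) : Prop :=
  MemH2 a ∧ (∀ q ∈ QBall, ‖evalS a q‖ ≤ 1) ∧ (∀ᵐ q ∂SigmaBd, ‖bdval a q‖ = 1)

/-- `g` is outer: whenever `f ∈ H²(𝔹)` has the same boundary modulus `Σ`-a.e.,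
then `‖g‖ ≥ ‖f‖` throughout `𝔹`. -/
def IsOuterQ (g : ℕ → Quaternion ℝ) : Prop :=
  MemH2 g ∧ ∀ f, MemH2 f → (∀ᵐ q ∂SigmaBd, ‖bdval g q‖ = ‖bdval f q‖) →
    ∀ q ∈ QBall, ‖evalS f q‖ ≤ ‖evalS g q‖

/-- Quaternionic polynomials (finitely supported coefficient sequences). -/
def IsPolyQ (p : ℕ → Quaternion ℝ) : Prop := ∃ N, ∀ n > N, p n = 0

/-- Quaternionic polynomials of degree at most `n` (the space `𝒫_n`). -/
def IsPolyDeg (p : ℕ → Quaternion ℝ) (n : ℕ) : Prop := ∀ m > n, p m = 0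

/-- The coefficient sequence of the monomial `qᵏ`. -/
def qpow (k : ℕ) : ℕ → Quaternion ℝ := fun n => if n = k then 1 else 0

/-- The coefficient sequence of a constant function. -/
def constS (c : Quaternion ℝ) : ℕ → Quaternion ℝ := fun n => if n = 0 then c else 0

/-- The coefficient sequence of the constant function `1`. -/
def oneS : ℕ → Quaternion ℝ := constS 1

/-- The invariant subspace `[g]`: the `H²`-closure of `{g * p : p polynomial}`,
i.e. of the right span of `{qⁿ * g : n ≥ 0}`. -/
def InvSub (g : ℕ → Quaternion ℝ) : Set (ℕ → Quaternion ℝ) :=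
  {h | MemH2 h ∧ ∀ ε : ℝ≥0∞, 0 < ε → ∃ p, IsPolyQ p ∧ h2distSq (sProd g p) h < ε}

/-- `g` is cyclic: `[g] = H²(𝔹)`. -/
def IsCyclicQ (g : ℕ → Quaternion ℝ) : Prop :=
  MemH2 g ∧ ∀ h, MemH2 h → h ∈ InvSub g

/-! ### Bilateral (slice `L²`) series, used for boundary products -/

/-- Bilateral coefficients of `f̃(q) = f(q̄)` on `∂𝔹`: `Σ_{n ≤ 0} qⁿ a_{-n}`. -/
def tildeZ (a : ℕ → Quaternion ℝ) : ℤ → Quaternion ℝ :=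
  fun k => if k ≤ 0 then a (-k).toNat else 0

/-- Bilateral coefficients of `fᶜ` on `∂𝔹`. -/
def conjZ (a : ℕ → Quaternion ℝ) : ℤ → Quaternion ℝ :=
  fun k => if 0 ≤ k then star (a k.toNat) else 0

/-- The `*`-product of two slice `L²` functions on the boundary, on coefficients. -/
def convZ (c b : ℤ → Quaternion ℝ) : ℤ → Quaternion ℝ := fun n => ∑' k : ℤ, c k * b (n - k)

/-- Evaluation of a bilateral series `q ↦ ∑_{n ∈ ℤ} qⁿ dₙ`. -/
def evalZ (d : ℤ → Quaternion ℝ) (q : Quaternion ℝ) : Quaternion ℝ := ∑' n : ℤ, q ^ n * d n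

/-- The slice inner product `⟨qᵏ * f, f⟩_I = (1/2π)∫₀^{2π} conj(f(e^{θI})) (e^{θI})ᵏ f(e^{θI}) dθ`,
computed with boundary values; note `(qᵏ * f)(q) = qᵏ f(q)` pointwise. -/
def sliceInnerPow (a : ℕ → Quaternion ℝ) (I : Quaternion ℝ) (k : ℕ) : Quaternion ℝ :=
  (2 * Real.pi)⁻¹ •
    ∫ t in Set.Ico 0 (2 * Real.pi), star (bdval a (ptOn I t)) * ((ptOn I t) ^ k * bdval a (ptOn I t))

/-! ### Complex Hardy space `H²(𝔻)` notions (for slice restrictions) -/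

/-- Membership in the complex Hardy space `H²(𝔻)` via coefficients. -/
def CMemH2 (c : ℕ → ℂ) : Prop := Summable (fun n => ‖c n‖ ^ 2)

/-- Evaluation of a complex power series. -/
def cEval (c : ℕ → ℂ) (z : ℂ) : ℂ := ∑' n, z ^ n * c n

/-- Cauchy product of complex coefficient sequences. -/
def cConv (c d : ℕ → ℂ) : ℕ → ℂ := fun n => ∑ k ∈ Finset.range (n + 1), c k * d (n - k)

/-- Squared `H²(𝔻)` distance. -/
def cDistSq (c d : ℕ → ℂ) : ℝ≥0∞ := ∑' n, (‖c n - d n‖₊ : ℝ≥0∞) ^ 2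

/-- Radial boundary values of a complex `H²` function. -/
def cBdval (c : ℕ → ℂ) (z : ℂ) : ℂ :=
  if h : ∃ L, Tendsto (fun r : ℝ => cEval c ((r : ℂ) * z)) (𝓝[<] (1 : ℝ)) (𝓝 L)
  then h.choose else 0

/-- Lebesgue measure on the unit circle `∂𝔻` (parametrized by `θ ∈ [0, 2π)`). -/
def circleM : Measure ℂ :=
  Measure.map (fun t : ℝ => Complex.exp (t * Complex.I)) (volume.restrict (Set.Ico 0 (2 * Real.pi)))

/-- Cyclicity in `H²(𝔻)`: polynomial multiples of `c` are dense. -/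
def CIsCyclic (c : ℕ → ℂ) : Prop :=
  CMemH2 c ∧ ∀ h, CMemH2 h → ∀ ε : ℝ≥0∞, 0 < ε →
    ∃ p : ℕ → ℂ, (∃ N, ∀ n > N, p n = 0) ∧ cDistSq (cConv c p) h < ε

/-- Outerness in `H²(𝔻)` (in the sense matching Definition 2.10 of the paper). -/
def CIsOuter (c : ℕ → ℂ) : Prop :=
  CMemH2 c ∧ ∀ h, CMemH2 h →
    (∀ᵐ z ∂circleM, ‖cBdval c z‖ = ‖cBdval h z‖) →
    ∀ z ∈ Metric.ball (0 : ℂ) 1, ‖cEval h z‖ ≤ ‖cEval c z‖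

/-- Complex coordinates of a point of the slice `L_I`: if `p = x + yI` then
`sliceToC I p = x + iy`. -/
def sliceToC (I : Quaternion ℝ) (p : Quaternion ℝ) : ℂ := ⟨p.re, -(p * I).re⟩

/-- The quaternion `i`. -/
def qI : Quaternion ℝ := ⟨0, 1, 0, 0⟩

/-- The embedding of `ℂ = L_i` into the quaternions. -/
def cToQ (z : ℂ) : Quaternion ℝ := (z.re : Quaternion ℝ) + z.im • qI

/-- The imaginary unit `I_ω` identified by `ω` (any imaginary unit if `ω` is real). -/
def Iu (ω : Quaternion ℝ) : Quaternion ℝ := if ω.im = 0 then qI else ‖ω.im‖⁻¹ • ω.im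

/-! ### Optimal approximants -/

/-- `p` is an optimal approximant of degree `n` of `f^{-*}`: `p ∈ 𝒫_n` minimizes
`‖f * p - 1‖_{H²}` among all `p ∈ 𝒫_n`. -/
def IsOptApprox (a : ℕ → Quaternion ℝ) (n : ℕ) (p : ℕ → Quaternion ℝ) : Prop :=
  IsPolyDeg p n ∧ ∀ r, IsPolyDeg r n → h2distSq (sProd a p) oneS ≤ h2distSq (sProd a r) oneS

end


/-- Poisson kernel. -/
noncomputable def pk (r t : ℝ) : ℝ := (1 - r ^ 2) / (1 - 2 * r * Real.cos t + r ^ 2)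

lemma pk_den_pos {r : ℝ} (h0 : 0 ≤ r) (h1 : r < 1) (t : ℝ) :
    0 < 1 - 2 * r * Real.cos t + r ^ 2 := by
  nlinarith [Real.cos_le_one t, sq_pos_of_pos (sub_pos.2 h1),
    mul_nonneg h0 (sub_nonneg.2 (Real.cos_le_one t))]

lemma pk_nonneg {r : ℝ} (h0 : 0 ≤ r) (h1 : r < 1) (t : ℝ) : 0 ≤ pk r t :=
  div_nonneg (by nlinarith) (pk_den_pos h0 h1 t).le

lemma pk_neg (r t : ℝ) : pk r (-t) = pk r t := by simp [pk]

lemma pk_contDiff {r : ℝ} (h0 : 0 ≤ r) (h1 : r < 1) : ContDiff ℝ 1 (pk r) := by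
  unfold pk
  refine ContDiff.div contDiff_const ?_ (fun t => (pk_den_pos h0 h1 t).ne')
  have := Real.contDiff_cos (n := 1)
  fun_prop

lemma pk_deriv {r : ℝ} (h0 : 0 ≤ r) (h1 : r < 1) (t : ℝ) :
    deriv (pk r) t = - ((1 - r ^ 2) * (2 * r * Real.sin t)) /
      (1 - 2 * r * Real.cos t + r ^ 2) ^ 2 := by
  apply HasDerivAt.deriv
  have hd : HasDerivAt (fun t => 1 - 2 * r * Real.cos t + r ^ 2) (2 * r * Real.sin t) t := by
    have := (((Real.hasDerivAt_cos t).const_mul (2 * r)).const_sub 1).add_const (r ^ 2)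
    simpa using this
  have := (hasDerivAt_const t (1 - r ^ 2)).div hd (pk_den_pos h0 h1 t).ne'
  rw [zero_mul, zero_sub] at this
  exact this

lemma byparts (p g : ℝ → ℝ) (hp : ContDiff ℝ 1 p) (a b : ℝ) (h0 : (0 : ℝ) ∈ Set.uIcc a b)
    (hg : ∀ a b, IntervalIntegrable g volume a b) :
    ∫ t in a..b, p t * g t = p b * (∫ s in (0)..b, g s) - p a * (∫ s in (0)..a, g s)
      - ∫ t in a..b, deriv p t * (∫ s in (0)..t, g s) := by
  have hW := (hg a b).absolutelyContinuousOnInterval_intervalIntegral (c := 0) h0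
  have := AbsolutelyContinuousOnInterval.integral_mul_deriv_eq_deriv_mul
    (hp.contDiffOn.absolutelyContinuousOnInterval (a := a) (b := b)) hW
  rw [← this]
  apply intervalIntegral.integral_congr_ae
  filter_upwards [(hg a b).ae_hasDerivAt_integral] with x hx hxm
  have hm : x ∈ Set.uIcc a b := Set.uIoc_subset_uIcc hxm
  rw [(hx hm 0 h0).deriv]

/-- Cauchy-type expansion. -/
lemma int_geom (g : ℝ → ℂ) (a b : ℝ) (hg : IntervalIntegrable g volume a b)
    (e : ℝ → ℂ) (hec : Continuous e) (r : ℝ) (h0 : 0 ≤ r) (h1 : r < 1)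
    (he : ∀ s, ‖e s‖ = r) :
    HasSum (fun n : ℕ => ∫ s in a..b, e s ^ n * g s) (∫ s in a..b, (1 - e s)⁻¹ * g s) := by
  refine intervalIntegral.hasSum_integral_of_dominated_convergence (fun n s => r ^ n * ‖g s‖)
    ?_ ?_ ?_ ?_ ?_
  · intro n
    exact ((hec.pow n).aestronglyMeasurable).mul hg.def'.aestronglyMeasurable
  · intro n
    refine Eventually.of_forall (fun t _ => ?_)
    rw [norm_mul, norm_pow, he]
  · refine Eventually.of_forall (fun t _ => ?_)
    exact (summable_geometric_of_lt_one h0 h1).mul_right _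
  · simp_rw [tsum_mul_right]
    exact hg.norm.const_mul _
  · refine Eventually.of_forall (fun t _ => ?_)
    have hh : ‖e t‖ < 1 := by rw [he]; exact h1
    exact (hasSum_geometric_of_norm_lt_one hh).mul_right (g t)

lemma pk_eq {r : ℝ} (h0 : 0 ≤ r) (h1 : r < 1) (t : ℝ) :
    (pk r t : ℂ) = (1 - (r : ℂ) * Complex.exp (-t * Complex.I))⁻¹ +
      (1 - (r : ℂ) * Complex.exp (t * Complex.I))⁻¹ - 1 := by
  have e1 : Complex.exp (-t * Complex.I) = Complex.cos t - Complex.sin t * Complex.I := by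
    rw [Complex.exp_mul_I]; simp; ring
  have e2 : Complex.exp (t * Complex.I) = Complex.cos t + Complex.sin t * Complex.I :=
    Complex.exp_mul_I _
  have n1 : (1 - (r : ℂ) * Complex.exp (-t * Complex.I)) ≠ 0 := by
    intro h
    have : ‖(r : ℂ) * Complex.exp (-t * Complex.I)‖ = 1 := by
      rw [← sub_eq_zero.1 h]; simp
    rw [norm_mul, ← Complex.ofReal_neg, Complex.norm_exp_ofReal_mul_I] at this
    simp [abs_of_nonneg h0] at this
    linarith
  have n2 : (1 - (r : ℂ) * Complex.exp (t * Complex.I)) ≠ 0 := by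
    intro h
    have : ‖(r : ℂ) * Complex.exp (t * Complex.I)‖ = 1 := by
      rw [← sub_eq_zero.1 h]; simp
    rw [norm_mul, Complex.norm_exp_ofReal_mul_I] at this
    simp [abs_of_nonneg h0] at this
    linarith
  have n3 : (1 - 2 * (r : ℂ) * Complex.cos t + (r : ℂ) ^ 2) ≠ 0 := by
    have := (pk_den_pos h0 h1 t).ne'
    exact_mod_cast this
  unfold pk
  push_cast
  rw [e1] at n1 ⊢
  rw [e2] at n2 ⊢
  have hcs : Complex.sin t ^ 2 + Complex.cos t ^ 2 = 1 := Complex.sin_sq_add_cos_sq _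
  have key : (1 - (r : ℂ) * (Complex.cos t - Complex.sin t * Complex.I)) *
      (1 - (r : ℂ) * (Complex.cos t + Complex.sin t * Complex.I)) =
      (1 - 2 * (r : ℂ) * Complex.cos t + (r : ℂ) ^ 2) := by
    linear_combination (r : ℂ) ^ 2 * hcs - (r : ℂ) ^ 2 * Complex.sin t ^ 2 * Complex.I_sq
  have : (1 - (r : ℂ) * (Complex.cos t - Complex.sin t * Complex.I))⁻¹ +
      (1 - (r : ℂ) * (Complex.cos t + Complex.sin t * Complex.I))⁻¹ - 1 =
      (((1 - (r : ℂ) * (Complex.cos t + Complex.sin t * Complex.I))) +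
      (1 - (r : ℂ) * (Complex.cos t - Complex.sin t * Complex.I)) -
      (1 - 2 * (r : ℂ) * Complex.cos t + (r : ℂ) ^ 2)) /
      (1 - 2 * (r : ℂ) * Complex.cos t + (r : ℂ) ^ 2) := by
    rw [← key]
    field_simp
  rw [this]
  congr 1
  ring

/-- Poisson representation. -/
lemma poisson_rep (g : ℝ → ℂ) (A : ℕ → ℂ) (hg : IntervalIntegrable g volume (-Real.pi) Real.pi)
    (hA : ∀ n : ℕ, ∫ s in (-Real.pi)..Real.pi, Complex.exp (-(s * Complex.I)) ^ n * g s
      = 2 * Real.pi * A n)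
    (hB : ∀ n : ℕ, ∫ s in (-Real.pi)..Real.pi, Complex.exp (s * Complex.I) ^ (n + 1) * g s = 0)
    {r : ℝ} (h0 : 0 ≤ r) (h1 : r < 1) (θ : ℝ) :
    ∫ s in (-Real.pi)..Real.pi, (pk r (s - θ) : ℂ) * g s
      = 2 * Real.pi * cEval A (r * Complex.exp (θ * Complex.I)) := by
  set e1 : ℝ → ℂ := fun s => (r : ℂ) * Complex.exp (-(s - θ : ℝ) * Complex.I) with he1
  set e2 : ℝ → ℂ := fun s => (r : ℂ) * Complex.exp ((s - θ : ℝ) * Complex.I) with he2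
  have c1 : Continuous e1 := by fun_prop
  have c2 : Continuous e2 := by fun_prop
  have m1 : ∀ s, ‖e1 s‖ = r := by
    intro s
    rw [he1]; simp only
    rw [norm_mul, ← Complex.ofReal_neg, Complex.norm_exp_ofReal_mul_I]; simp [abs_of_nonneg h0]
  have m2 : ∀ s, ‖e2 s‖ = r := by
    intro s
    rw [he2]; simp only
    rw [norm_mul, Complex.norm_exp_ofReal_mul_I]; simp [abs_of_nonneg h0]
  have s1 := int_geom g _ _ hg e1 c1 r h0 h1 m1
  have s2 := int_geom g _ _ hg e2 c2 r h0 h1 m2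
  have v1 : ∀ n : ℕ, ∫ s in (-Real.pi)..Real.pi, e1 s ^ n * g s
      = 2 * Real.pi * ((r * Complex.exp (θ * Complex.I)) ^ n * A n) := by
    intro n
    have : ∀ s, e1 s ^ n * g s = (r * Complex.exp (θ * Complex.I)) ^ n *
        (Complex.exp (-(s * Complex.I)) ^ n * g s) := by
      intro s
      rw [he1]; simp only
      rw [← mul_assoc, ← mul_pow, mul_assoc (r : ℂ), ← Complex.exp_add]
      congr 4
      push_cast; ring
    simp_rw [this]
    rw [intervalIntegral.integral_const_mul, hA]; ring
  have v2 : ∀ n : ℕ, ∫ s in (-Real.pi)..Real.pi, e2 s ^ (n + 1) * g s = 0 := by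
    intro n
    have : ∀ s, e2 s ^ (n + 1) * g s = (r * Complex.exp (-(θ * Complex.I))) ^ (n + 1) *
        (Complex.exp (s * Complex.I) ^ (n + 1) * g s) := by
      intro s
      rw [he2]; simp only
      rw [← mul_assoc, ← mul_pow, mul_assoc (r : ℂ), ← Complex.exp_add]
      congr 4
      push_cast; ring
    simp_rw [this]
    rw [intervalIntegral.integral_const_mul, hB]; ring
  have w1 : ∫ s in (-Real.pi)..Real.pi, (1 - e1 s)⁻¹ * g s =
      2 * Real.pi * cEval A (r * Complex.exp (θ * Complex.I)) := by
    rw [← s1.tsum_eq, cEval, ← tsum_mul_left]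
    exact tsum_congr v1
  have w2 : ∫ s in (-Real.pi)..Real.pi, (1 - e2 s)⁻¹ * g s =
      ∫ s in (-Real.pi)..Real.pi, g s := by
    have := hasSum_single (f := fun n : ℕ => ∫ s in (-Real.pi)..Real.pi, e2 s ^ n * g s) 0
      (by intro n hn; obtain ⟨m, rfl⟩ := Nat.exists_eq_succ_of_ne_zero hn; exact v2 m)
    have h := s2.unique this
    simpa using h
  have ne1 : ∀ s, 1 - e1 s ≠ 0 := by
    intro s h
    have := m1 s
    rw [← sub_eq_zero.1 h] at this
    simp at this; linarith
  have ne2 : ∀ s, 1 - e2 s ≠ 0 := by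
    intro s h
    have := m2 s
    rw [← sub_eq_zero.1 h] at this
    simp at this; linarith
  have i1 : IntervalIntegrable (fun s => (1 - e1 s)⁻¹ * g s) volume (-Real.pi) Real.pi :=
    hg.continuousOn_mul ((continuous_const.sub c1).inv₀ ne1).continuousOn
  have i2 : IntervalIntegrable (fun s => (1 - e2 s)⁻¹ * g s) volume (-Real.pi) Real.pi :=
    hg.continuousOn_mul ((continuous_const.sub c2).inv₀ ne2).continuousOn
  have : ∀ s, (pk r (s - θ) : ℂ) * g s = (1 - e1 s)⁻¹ * g s + (1 - e2 s)⁻¹ * g s - g s := by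
    intro s
    rw [pk_eq h0 h1]
    simp only [he1, he2]
    ring
  simp_rw [this]
  rw [intervalIntegral.integral_sub (i1.add i2) hg, intervalIntegral.integral_add i1 i2, w1, w2]
  ring


lemma int_exp (m : ℤ) (hm : m ≠ 0) :
    ∫ s in (-Real.pi)..Real.pi, Complex.exp ((m * Complex.I) * (s : ℂ)) = 0 := by
  have hc : (m : ℂ) * Complex.I ≠ 0 := mul_ne_zero (by exact_mod_cast hm) Complex.I_ne_zero
  rw [integral_exp_mul_complex hc]
  have : Complex.exp (m * Complex.I * (Real.pi : ℝ)) =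
      Complex.exp (m * Complex.I * ((-Real.pi : ℝ) : ℂ)) := by
    rw [Complex.exp_eq_exp_iff_exists_int]
    exact ⟨m, by push_cast; ring⟩
  rw [this]; simp

lemma int_pk_exp (k : ℕ) {r : ℝ} (h0 : 0 ≤ r) (h1 : r < 1) :
    ∫ s in (-Real.pi)..Real.pi, (pk r s : ℂ) * Complex.exp ((k * Complex.I) * (s : ℂ))
      = 2 * Real.pi * r ^ k := by
  have h := poisson_rep (fun s : ℝ => Complex.exp ((k * Complex.I) * (s : ℂ)))
    (fun n => if n = k then 1 else 0)
    (Continuous.intervalIntegrable (by fun_prop) _ _) ?_ ?_ h0 h1 0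
  · simp only [sub_zero] at h
    rw [h, cEval, tsum_eq_single k]
    · simp
    · intro n hn; simp [hn]
  · intro n
    have : ∀ s : ℝ, Complex.exp (-(s * Complex.I)) ^ n * Complex.exp ((k * Complex.I) * (s : ℂ))
        = Complex.exp ((((k : ℤ) - n : ℤ) * Complex.I) * (s : ℂ)) := by
      intro s
      rw [← Complex.exp_nat_mul, ← Complex.exp_add]
      congr 1; push_cast; ring
    simp_rw [this]
    by_cases hk : n = k
    · subst hk
      simp; ring
    · rw [int_exp _ (by omega)]; simp [hk]
  · intro n
    have : ∀ s : ℝ, Complex.exp (s * Complex.I) ^ (n + 1) *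
        Complex.exp ((k * Complex.I) * (s : ℂ))
        = Complex.exp ((((k : ℤ) + n + 1 : ℤ) * Complex.I) * (s : ℂ)) := by
      intro s
      rw [← Complex.exp_nat_mul, ← Complex.exp_add]
      congr 1; push_cast; ring
    simp_rw [this]
    exact int_exp _ (by omega)

lemma int_pk {r : ℝ} (h0 : 0 ≤ r) (h1 : r < 1) :
    ∫ s in (-Real.pi)..Real.pi, pk r s = 2 * Real.pi := by
  have h := int_pk_exp 0 h0 h1
  simp only [CharP.cast_eq_zero, zero_mul, Complex.exp_zero, mul_one, pow_zero] at h
  rw [intervalIntegral.integral_ofReal] at h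
  exact_mod_cast h

lemma int_pk_cos {r : ℝ} (h0 : 0 ≤ r) (h1 : r < 1) :
    ∫ s in (-Real.pi)..Real.pi, pk r s * Real.cos s = 2 * Real.pi * r := by
  have h := int_pk_exp 1 h0 h1
  have hc := (pk_contDiff h0 h1).continuous
  have h2 := congrArg Complex.reCLM h
  rw [← ContinuousLinearMap.intervalIntegral_comp_comm _
    (Continuous.intervalIntegrable (by fun_prop) _ _)] at h2
  have e : ∀ s : ℝ, Complex.reCLM ((pk r s : ℂ) * Complex.exp ((((1 : ℕ) : ℂ) * Complex.I) * s))
      = pk r s * Real.cos s := by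
    intro s
    have : ((((1 : ℕ) : ℂ) * Complex.I) * s) = (s : ℂ) * Complex.I := by push_cast; ring
    rw [this, Complex.reCLM_apply, Complex.re_ofReal_mul, Complex.exp_ofReal_mul_I_re]
  simp_rw [e] at h2
  rw [h2]
  have : (2 * Real.pi * (r : ℂ) ^ 1 : ℂ) = ((2 * Real.pi * r : ℝ) : ℂ) := by push_cast; ring
  rw [this]; simp

lemma int_dpk_sin {r : ℝ} (h0 : 0 ≤ r) (h1 : r < 1) :
    ∫ s in (-Real.pi)..Real.pi, deriv (pk r) s * Real.sin s = - (2 * Real.pi * r) := by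
  have h := byparts (pk r) Real.cos (pk_contDiff h0 h1) (-Real.pi) Real.pi
    (by rw [Set.uIcc_of_le (by linarith [Real.pi_pos])]; constructor <;> linarith [Real.pi_pos])
    (fun a b => Real.continuous_cos.intervalIntegrable a b)
  rw [int_pk_cos h0 h1] at h
  simp at h
  linarith

lemma fatou_real (g : ℝ → ℝ) (hg : ∀ a b, IntervalIntegrable g volume a b) (c : ℝ)
    (hd : HasDerivAt (fun x => ∫ t in (0)..x, g t) c 0) :
    Tendsto (fun r => ∫ t in (-Real.pi)..Real.pi, pk r t * g t) (𝓝[<] (1 : ℝ))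
      (𝓝 (2 * Real.pi * c)) := by
  have hpi := Real.pi_pos
  set W : ℝ → ℝ := fun x => ∫ t in (0)..x, g t with hW
  set V : ℝ → ℝ := fun x => W x - c * Real.sin x with hV
  have hWc : Continuous W := intervalIntegral.continuous_primitive hg 0
  have hVc : Continuous V := by fun_prop
  have hW0 : W 0 = 0 := by simp [hW]
  -- V is o(sin) at 0
  have hVd : HasDerivAt V 0 0 := by
    have := hd.sub ((Real.hasDerivAt_sin 0).const_mul c)
    rw [Real.cos_zero, mul_one, sub_self] at this
    exact this
  have hVo : ∀ ε > 0, ∃ δ > 0, δ < Real.pi ∧ ∀ t, |t| < δ → |V t| ≤ ε * |Real.sin t| := by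
    intro ε hε
    have h1 := (hasDerivAt_iff_isLittleO.1 hVd).def (c := ε / 2) (by positivity)
    have hV0 : V 0 = 0 := by simp [hV, hW0]
    simp only [hV0, sub_zero, smul_zero, Real.norm_eq_abs] at h1
    obtain ⟨δ, hδ, h2⟩ := Metric.eventually_nhds_iff.1 h1
    refine ⟨min δ 1, by positivity, lt_of_le_of_lt (min_le_right _ _) (by linarith [Real.pi_gt_three]), ?_⟩
    intro t ht
    have ht1 : |t| ≤ 1 := (ht.trans_le (min_le_right _ _)).le
    have h3 := h2 (y := t) (by simpa [Real.dist_eq] using ht.trans_le (min_le_left _ _))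
    have h4 : |t| ≤ 2 * |Real.sin t| := by
      have h5 := Real.mul_le_sin (x := |t|) (abs_nonneg t) (by linarith [Real.pi_gt_three])
      have h6 : Real.sin |t| ≤ |Real.sin t| := by
        rcases abs_cases t with ⟨h, _⟩ | ⟨h, _⟩ <;> rw [h]
        · exact le_abs_self _
        · rw [Real.sin_neg]; exact neg_le_abs _
      have h7 : (1:ℝ) / 2 ≤ 2 / Real.pi := by
        rw [div_le_div_iff₀ (by norm_num) hpi]; linarith [Real.pi_le_four]
      nlinarith [mul_le_mul_of_nonneg_right h7 (abs_nonneg t)]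
    calc |V t| ≤ ε / 2 * |t| := h3
      _ ≤ ε / 2 * (2 * |Real.sin t|) := by gcongr
      _ = _ := by ring
  obtain ⟨M, hM⟩ := isCompact_Icc.exists_bound_of_continuousOn (s := Set.Icc (-Real.pi) Real.pi)
    hVc.continuousOn
  have hM0 : 0 ≤ M := (norm_nonneg _).trans (hM 0 ⟨by linarith, by linarith⟩)
  have h0mem : (0 : ℝ) ∈ Set.uIcc (-Real.pi) Real.pi := by
    rw [Set.uIcc_of_le (by linarith)]; constructor <;> linarith
  -- the formula
  have formula : ∀ r : ℝ, 0 ≤ r → r < 1 → ∫ t in (-Real.pi)..Real.pi, pk r t * g t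
      = pk r Real.pi * (W Real.pi - W (-Real.pi)) + 2 * Real.pi * r * c
        - ∫ t in (-Real.pi)..Real.pi, deriv (pk r) t * V t := by
    intro r h0 h1
    have hdc : Continuous (deriv (pk r)) := (pk_contDiff h0 h1).continuous_deriv le_rfl
    rw [byparts (pk r) g (pk_contDiff h0 h1) _ _ h0mem hg, pk_neg]
    have e : ∀ t, deriv (pk r) t * V t = deriv (pk r) t * W t - c * (deriv (pk r) t * Real.sin t) := by
      intro t; simp only [hV]; ring
    simp_rw [e]
    rw [intervalIntegral.integral_sub (Continuous.intervalIntegrable (by fun_prop) _ _)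
      (Continuous.intervalIntegrable (by fun_prop) _ _), intervalIntegral.integral_const_mul,
      int_dpk_sin h0 h1]
    ring
  have hr : ∀ᶠ r in 𝓝[<] (1 : ℝ), 1 / 2 < r ∧ r < 1 := by
    filter_upwards [Ioo_mem_nhdsLT (show (1/2 : ℝ) < 1 by norm_num)] with r hr using hr
  have key : Tendsto (fun r => ∫ t in (-Real.pi)..Real.pi, deriv (pk r) t * V t)
      (𝓝[<] (1 : ℝ)) (𝓝 0) := by
    rw [Metric.tendsto_nhds]
    intro ε hε
    obtain ⟨δ, hδ, hδπ, hδV⟩ := hVo (ε / (4 * Real.pi)) (by positivity)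
    have hcos : 0 < 1 - Real.cos δ := by
      have := Real.cos_lt_cos_of_nonneg_of_le_pi le_rfl hδπ.le hδ
      simp at this; linarith
    set D := 1 - Real.cos δ with hD
    have lim : Tendsto (fun r : ℝ => M * (2 * (1 - r ^ 2)) / D ^ 2 * (2 * Real.pi)) (𝓝[<] (1 : ℝ))
        (𝓝 0) := by
      have : Continuous (fun r : ℝ => M * (2 * (1 - r ^ 2)) / D ^ 2 * (2 * Real.pi)) := by fun_prop
      have := (this.tendsto 1).mono_left (nhdsWithin_le_nhds (s := Set.Iio 1))
      simpa using this
    filter_upwards [hr, lim.eventually (gt_mem_nhds (show (0 : ℝ) < ε / 2 by positivity))]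
      with r ⟨hr0, hr1⟩ hlim
    have h0 : 0 ≤ r := by linarith
    have hdc : Continuous (deriv (pk r)) := (pk_contDiff h0 hr1).continuous_deriv le_rfl
    rw [dist_zero_right]
    have bd : ∀ t ∈ Set.Icc (-Real.pi) Real.pi, ‖deriv (pk r) t * V t‖ ≤
        ε / (4 * Real.pi) * (-(deriv (pk r) t * Real.sin t)) + M * (2 * (1 - r ^ 2)) / D ^ 2 := by
      intro t ht
      have hdp := pk_den_pos h0 hr1 t
      have h1r : 0 ≤ 1 - r ^ 2 := by nlinarith
      have hsgn : -(deriv (pk r) t * Real.sin t) = |deriv (pk r) t| * |Real.sin t| := by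
        rw [← abs_mul]
        have : deriv (pk r) t * Real.sin t ≤ 0 := by
          rw [pk_deriv h0 hr1]
          have : -((1 - r ^ 2) * (2 * r * Real.sin t)) / (1 - 2 * r * Real.cos t + r ^ 2) ^ 2
              * Real.sin t = - ((1 - r ^ 2) * (2 * r * Real.sin t ^ 2) /
              (1 - 2 * r * Real.cos t + r ^ 2) ^ 2) := by ring
          rw [this]
          have : 0 ≤ (1 - r ^ 2) * (2 * r * Real.sin t ^ 2) /
              (1 - 2 * r * Real.cos t + r ^ 2) ^ 2 := by positivity
          linarith
        rw [abs_of_nonpos this]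
      rw [hsgn, norm_mul, Real.norm_eq_abs, Real.norm_eq_abs]
      have hB : 0 ≤ M * (2 * (1 - r ^ 2)) / D ^ 2 := by positivity
      by_cases htd : |t| < δ
      · have := mul_le_mul_of_nonneg_left (hδV t htd) (abs_nonneg (deriv (pk r) t))
        calc _ ≤ _ := this
          _ = ε / (4 * Real.pi) * (|deriv (pk r) t| * |Real.sin t|) := by ring
          _ ≤ _ := by linarith
      · push Not at htd
        have hct : Real.cos t ≤ Real.cos δ := by
          rw [← Real.cos_abs t]
          exact Real.cos_le_cos_of_nonneg_of_le_pi hδ.le (abs_le.2 ht) htd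
        have hDle : D ≤ 1 - 2 * r * Real.cos t + r ^ 2 := by
          nlinarith [sq_nonneg (1 - r), Real.cos_le_one t]
        have hdb : |deriv (pk r) t| ≤ 2 * (1 - r ^ 2) / D ^ 2 := by
          rw [pk_deriv h0 hr1, abs_div, abs_neg, abs_mul, abs_mul, abs_of_nonneg h1r,
            abs_of_pos (pow_pos hdp 2), abs_of_nonneg (by linarith : 0 ≤ 2 * r)]
          apply div_le_div₀ (by positivity) _ (by positivity) (by gcongr)
          have hs : |Real.sin t| ≤ 1 := Real.abs_sin_le_one t
          have : 2 * r * |Real.sin t| ≤ 2 := by nlinarith [abs_nonneg (Real.sin t)]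
          nlinarith
        have hMt := hM t ht
        rw [Real.norm_eq_abs] at hMt
        have h9 : 0 ≤ ε / (4 * Real.pi) * (|deriv (pk r) t| * |Real.sin t|) := by positivity
        calc _ ≤ 2 * (1 - r ^ 2) / D ^ 2 * M := by gcongr
          _ = M * (2 * (1 - r ^ 2)) / D ^ 2 := by ring
          _ ≤ _ := by linarith
    have h5 : ‖∫ t in (-Real.pi)..Real.pi, deriv (pk r) t * V t‖ ≤
        ∫ t in (-Real.pi)..Real.pi,
          (ε / (4 * Real.pi) * (-(deriv (pk r) t * Real.sin t)) + M * (2 * (1 - r ^ 2)) / D ^ 2) := by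
      apply intervalIntegral.norm_integral_le_of_norm_le (by linarith)
      · exact Eventually.of_forall (fun t ht => bd t ⟨ht.1.le, ht.2⟩)
      · exact Continuous.intervalIntegrable (by fun_prop) _ _
    rw [intervalIntegral.integral_add (Continuous.intervalIntegrable (by fun_prop) _ _)
      (Continuous.intervalIntegrable (by fun_prop) _ _), intervalIntegral.integral_const_mul,
      intervalIntegral.integral_neg, int_dpk_sin h0 hr1, intervalIntegral.integral_const] at h5
    have h6 : ε / (4 * Real.pi) * (- -(2 * Real.pi * r)) = ε / 2 * r := by
      field_simp; ring
    rw [h6, smul_eq_mul] at h5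
    have : ε / 2 * r ≤ ε / 2 := by nlinarith
    have h7 : (Real.pi - -Real.pi) * (M * (2 * (1 - r ^ 2)) / D ^ 2) =
      M * (2 * (1 - r ^ 2)) / D ^ 2 * (2 * Real.pi) := by ring
    linarith
  have lim1 : Tendsto (fun r => pk r Real.pi * (W Real.pi - W (-Real.pi)) + 2 * Real.pi * r * c)
      (𝓝[<] (1 : ℝ)) (𝓝 (2 * Real.pi * c)) := by
    have : ContinuousAt (fun r => pk r Real.pi * (W Real.pi - W (-Real.pi)) + 2 * Real.pi * r * c) 1 := by
      unfold pk
      have : (1 - 2 * (1:ℝ) * Real.cos Real.pi + 1 ^ 2) ≠ 0 := by simp; norm_num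
      fun_prop (disch := assumption)
    have h := this.tendsto.mono_left (nhdsWithin_le_nhds (s := Set.Iio 1))
    simpa [pk] using h
  have := lim1.sub key
  rw [sub_zero] at this
  refine this.congr' ?_
  filter_upwards [hr] with r ⟨h0, h1⟩
  rw [formula r (by linarith) h1]


lemma exists_bdry (A : ℕ → ℂ) (hA : CMemH2 A) : ∃ g : ℝ → ℂ, Function.Periodic g (2 * Real.pi) ∧
    (∀ a b, IntervalIntegrable g volume a b) ∧
    (∀ n : ℕ, ∫ s in (-Real.pi)..Real.pi, Complex.exp (-(s * Complex.I)) ^ n * g s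
      = 2 * Real.pi * A n) ∧
    (∀ n : ℕ, ∫ s in (-Real.pi)..Real.pi, Complex.exp (s * Complex.I) ^ (n + 1) * g s = 0) := by
  have hpi := Real.pi_pos
  have : Fact (0 < 2 * Real.pi) := ⟨by positivity⟩
  let c : ℤ → ℂ := fun k => if 0 ≤ k then A k.toNat else 0
  have hc : Memℓp c 2 := by
    apply memℓp_gen
    have e : (fun k : ℤ => ‖c k‖ ^ (2 : ℝ≥0∞).toReal) = fun k => ‖c k‖ ^ 2 := by
      funext k; norm_num
    rw [e]
    apply Summable.of_nat_of_neg
    · simpa [c] using (show Summable (fun n => ‖A n‖ ^ 2) from hA)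
    · have : (fun n : ℕ => ‖c (-(n : ℤ))‖ ^ 2) = fun n => if n = 0 then ‖A 0‖ ^ 2 else 0 := by
        funext n
        rcases Nat.eq_zero_or_pos n with h | h
        · subst h; simp [c]
        · have : ¬ (0 ≤ -(n : ℤ)) := by omega
          simp [c, h.ne']
      rw [this]
      exact (hasSum_ite_eq 0 _).summable
  let F : Lp ℂ 2 (@AddCircle.haarAddCircle (2 * Real.pi) _) := fourierBasis.repr.symm ⟨c, hc⟩
  have hF : ∀ k : ℤ, fourierCoeff (F : AddCircle (2 * Real.pi) → ℂ) k = c k := by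
    intro k
    rw [← fourierBasis_repr]
    simp [F]
  let g : ℝ → ℂ := fun s => (F : AddCircle (2 * Real.pi) → ℂ) (s : AddCircle (2 * Real.pi))
  have hper : Function.Periodic g (2 * Real.pi) := by
    intro s
    simp only [g]
    rw [AddCircle.coe_add_period]
  have hint : ∀ a b, IntervalIntegrable g volume a b := by
    apply hper.intervalIntegrable (by positivity) (t := 0)
    rw [intervalIntegrable_iff_integrableOn_Ioc_of_le (by linarith)]
    have h1 : Integrable (F : AddCircle (2 * Real.pi) → ℂ) AddCircle.haarAddCircle :=
      (Lp.memLp F).integrable (by norm_num)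
    have h2 : Integrable (F : AddCircle (2 * Real.pi) → ℂ) volume := by
      rw [AddCircle.volume_eq_smul_haarAddCircle]
      exact h1.smul_measure ENNReal.ofReal_ne_top
    exact (AddCircle.measurePreserving_mk (2 * Real.pi) 0).integrable_comp_of_integrable h2
  have hco : ∀ k : ℤ, ∫ s in (-Real.pi)..Real.pi, Complex.exp (-(k * (s * Complex.I))) * g s
      = 2 * Real.pi * c k := by
    intro k
    have h := fourierCoeff_eq_intervalIntegral (F : AddCircle (2 * Real.pi) → ℂ) k (-Real.pi)
    rw [hF] at h
    have e : -Real.pi + 2 * Real.pi = Real.pi := by ring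
    rw [e] at h
    rw [h]
    have e2 : ∀ s : ℝ, fourier (-k) (s : AddCircle (2 * Real.pi)) •
        (F : AddCircle (2 * Real.pi) → ℂ) s = Complex.exp (-(k * (s * Complex.I))) * g s := by
      intro s
      rw [fourier_coe_apply, smul_eq_mul]
      congr 2
      have : (Real.pi : ℂ) ≠ 0 := by exact_mod_cast hpi.ne'
      push_cast
      field_simp
    simp_rw [e2]
    rw [Complex.real_smul]
    have : (Real.pi : ℂ) ≠ 0 := by exact_mod_cast hpi.ne'
    push_cast
    rw [← mul_assoc, mul_one_div_cancel (mul_ne_zero two_ne_zero this), one_mul]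
  refine ⟨g, hper, hint, ?_, ?_⟩
  · intro n
    have := hco n
    simp only [c] at this
    simp only [Nat.cast_nonneg, if_true, Int.toNat_natCast] at this
    rw [← this]
    congr 1; funext s
    rw [← Complex.exp_nat_mul]; congr 2; push_cast; ring
  · intro n
    have := hco (-(n + 1 : ℕ))
    have h2 : ¬ ((0 : ℤ) ≤ (-((n + 1 : ℕ) : ℤ))) := by omega
    simp only [c, if_neg h2, mul_zero] at this
    rw [← this]
    congr 1; funext s
    rw [← Complex.exp_nat_mul]; congr 2; push_cast; ring

theorem hardy (A : ℕ → ℂ) (hA : CMemH2 A) : ∃ g : ℝ → ℂ, Function.Periodic g (2 * Real.pi) ∧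
    (∀ a b, IntervalIntegrable g volume a b) ∧
    (∀ r θ : ℝ, 0 ≤ r → r < 1 → ∫ t in (-Real.pi)..Real.pi, (pk r t : ℂ) * g (θ + t) =
      2 * Real.pi * cEval A (r * Complex.exp (θ * Complex.I))) ∧
    ∀ᵐ θ : ℝ, Tendsto (fun r : ℝ => cEval A (r * Complex.exp (θ * Complex.I))) (𝓝[<] (1 : ℝ))
      (𝓝 (g θ)) := by
  obtain ⟨g, hper, hint, hp, hn⟩ := exists_bdry A hA
  have hpi := Real.pi_pos
  have rep : ∀ r θ : ℝ, 0 ≤ r → r < 1 → ∫ t in (-Real.pi)..Real.pi, (pk r t : ℂ) * g (θ + t) =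
      2 * Real.pi * cEval A (r * Complex.exp (θ * Complex.I)) := by
    intro r θ h0 h1
    rw [← poisson_rep g A (hint _ _) hp hn h0 h1 θ]
    have h1 : ∫ t in (-Real.pi)..Real.pi, (pk r t : ℂ) * g (θ + t) =
        ∫ t in (-Real.pi)..Real.pi, (fun s => (pk r (s - θ) : ℂ) * g s) (t + θ) := by
      congr 1; funext t; simp [add_comm]
    rw [h1, intervalIntegral.integral_comp_add_right (fun s => (pk r (s - θ) : ℂ) * g s)]
    have hper2 : Function.Periodic (fun s => (pk r (s - θ) : ℂ) * g s) (2 * Real.pi) := by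
      intro s
      simp only
      rw [hper s]
      have : pk r (s + 2 * Real.pi - θ) = pk r (s - θ) := by
        unfold pk
        have : s + 2 * Real.pi - θ = s - θ + 2 * Real.pi := by ring
        rw [this, Real.cos_add_two_pi]
      rw [this]
    have := hper2.intervalIntegral_add_eq (-Real.pi + θ) (-Real.pi)
    have e1 : -Real.pi + θ + 2 * Real.pi = Real.pi + θ := by ring
    have e2 : -Real.pi + 2 * Real.pi = Real.pi := by ring
    rw [e1, e2] at this
    exact this
  refine ⟨g, hper, hint, rep, ?_⟩
  have hloc : LocallyIntegrable g volume := by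
    intro x
    refine ⟨Set.Ioo (x - 1) (x + 1), Ioo_mem_nhds (by linarith) (by linarith), ?_⟩
    have := hint (x - 1) (x + 1)
    rw [intervalIntegrable_iff_integrableOn_Ioo_of_le (by linarith)] at this
    exact this
  filter_upwards [LocallyIntegrable.ae_hasDerivAt_integral hloc] with θ hθ
  have hθ := hθ θ
  have hsh : ∀ a b, IntervalIntegrable (fun t => g (θ + t)) volume a b := by
    intro a b
    have := (hint (a + θ) (b + θ)).comp_add_left θ
    simpa using this
  have hd : HasDerivAt (fun x => ∫ t in (0)..x, g (θ + t)) (g θ) 0 := by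
    have h1 : (fun x => ∫ t in (0)..x, g (θ + t)) = fun x => (fun y => ∫ t in θ..y, g t) (θ + x) := by
      funext x
      rw [intervalIntegral.integral_comp_add_left (fun t => g t)]; simp
    rw [h1]
    exact HasDerivAt.comp_const_add (f := fun y => ∫ t in θ..y, g t) θ 0
      (by rw [add_zero]; exact hθ)
  have hRe : Tendsto (fun r => ∫ t in (-Real.pi)..Real.pi, pk r t * (g (θ + t)).re) (𝓝[<] (1 : ℝ))
      (𝓝 (2 * Real.pi * (g θ).re)) := by
    apply fatou_real (fun t => (g (θ + t)).re)
    · intro a b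
      exact ⟨(hsh a b).1.re, (hsh a b).2.re⟩
    · have := Complex.reCLM.hasFDerivAt.comp_hasDerivAt 0 hd
      refine this.congr_of_eventuallyEq (Eventually.of_forall (fun x => ?_))
      exact (ContinuousLinearMap.intervalIntegral_comp_comm Complex.reCLM (hsh 0 x))
  have hIm : Tendsto (fun r => ∫ t in (-Real.pi)..Real.pi, pk r t * (g (θ + t)).im) (𝓝[<] (1 : ℝ))
      (𝓝 (2 * Real.pi * (g θ).im)) := by
    apply fatou_real (fun t => (g (θ + t)).im)
    · intro a b
      exact ⟨(hsh a b).1.im, (hsh a b).2.im⟩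
    · have := Complex.imCLM.hasFDerivAt.comp_hasDerivAt 0 hd
      refine this.congr_of_eventuallyEq (Eventually.of_forall (fun x => ?_))
      exact (ContinuousLinearMap.intervalIntegral_comp_comm Complex.imCLM (hsh 0 x))
  have hlim := ((Complex.continuous_ofReal.tendsto _).comp hRe).add
    (((Complex.continuous_ofReal.tendsto _).comp hIm).mul_const Complex.I)
  have hlim2 := hlim.const_mul (1 / (2 * Real.pi : ℂ))
  have hpc : (Real.pi : ℂ) ≠ 0 := by exact_mod_cast hpi.ne'
  have ev : (1 / (2 * Real.pi : ℂ)) * (((2 * Real.pi * (g θ).re : ℝ) : ℂ) +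
      ((2 * Real.pi * (g θ).im : ℝ) : ℂ) * Complex.I) = g θ := by
    conv_rhs => rw [← Complex.re_add_im (g θ)]
    push_cast
    field_simp
  rw [ev] at hlim2
  refine hlim2.congr' ?_
  filter_upwards [Ioo_mem_nhdsLT (show (0 : ℝ) < 1 by norm_num)] with r hr
  have h := rep r θ hr.1.le hr.2
  have hc := (pk_contDiff hr.1.le hr.2).continuous
  have hci : Continuous (fun t => (pk r t : ℂ)) := by fun_prop
  have hii : IntervalIntegrable (fun t => (pk r t : ℂ) * g (θ + t)) volume (-Real.pi) Real.pi :=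
    (hsh _ _).continuousOn_mul hci.continuousOn
  have h1 := ContinuousLinearMap.intervalIntegral_comp_comm Complex.reCLM hii
  have h2 := ContinuousLinearMap.intervalIntegral_comp_comm Complex.imCLM hii
  simp only [Complex.reCLM_apply, Complex.imCLM_apply, Complex.re_ofReal_mul,
    Complex.im_ofReal_mul] at h1 h2
  simp only [Function.comp]
  rw [h1, h2, Complex.re_add_im, h]
  field_simp


lemma usphere_iff (K : Quaternion ℝ) :
    K ∈ USphere ↔ K.re = 0 ∧ K.imI ^ 2 + K.imJ ^ 2 + K.imK ^ 2 = 1 := by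
  have h : K ^ 2 = -1 ↔ (K.re * K.re - K.imI * K.imI - K.imJ * K.imJ - K.imK * K.imK = -1 ∧
      2 * K.re * K.imI = 0 ∧ 2 * K.re * K.imJ = 0 ∧ 2 * K.re * K.imK = 0) := by
    rw [sq, Quaternion.ext_iff]
    simp only [Quaternion.re_mul, Quaternion.imI_mul, Quaternion.imJ_mul, Quaternion.imK_mul,
      Quaternion.re_neg, Quaternion.imI_neg, Quaternion.imJ_neg, Quaternion.imK_neg,
      Quaternion.re_one, Quaternion.imI_one, Quaternion.imJ_one, Quaternion.imK_one, neg_zero]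
    constructor
    · rintro ⟨h1, h2, h3, h4⟩
      exact ⟨by linarith, by linarith, by linarith, by linarith⟩
    · rintro ⟨h1, h2, h3, h4⟩
      exact ⟨by linarith, by linarith, by linarith, by linarith⟩
  change K ^ 2 = -1 ↔ _
  rw [h]
  constructor
  · rintro ⟨h1, h2, h3, h4⟩
    by_cases h0 : K.re = 0
    · refine ⟨h0, ?_⟩
      rw [h0] at h1; linarith
    · have a1 : K.imI = 0 := by simpa [h0] using h2
      have a2 : K.imJ = 0 := by simpa [h0] using h3
      have a3 : K.imK = 0 := by simpa [h0] using h4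
      rw [a1, a2, a3] at h1
      nlinarith [mul_self_nonneg K.re]
  · rintro ⟨h0, h1⟩
    rw [h0]
    refine ⟨by linarith, by simp, by simp, by simp⟩

lemma usphere_mul {K : Quaternion ℝ} (hK : K ∈ USphere) : K * K = -1 := by
  rw [← sq]; exact hK

lemma usphere_star {K : Quaternion ℝ} (hK : K ∈ USphere) : star K = -K := by
  have := ((usphere_iff K).1 hK).1
  ext <;> simp [this]

lemma usphere_norm {K : Quaternion ℝ} (hK : K ∈ USphere) : ‖K‖ = 1 := by
  have h : ‖K‖ * ‖K‖ = 1 := by rw [← norm_mul, usphere_mul hK]; simp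
  nlinarith [norm_nonneg K]

/-- embedding of `ℂ` as the slice through `K`. -/
noncomputable def iot (K : Quaternion ℝ) (z : ℂ) : Quaternion ℝ :=
  (z.re : Quaternion ℝ) + z.im • K

lemma iot_eq (K : Quaternion ℝ) (z : ℂ) : iot K z = z.re • (1 : Quaternion ℝ) + z.im • K := by
  unfold iot
  congr 1
  exact Algebra.algebraMap_eq_smul_one (A := Quaternion ℝ) z.re

lemma iot_add (K : Quaternion ℝ) (z w : ℂ) : iot K (z + w) = iot K z + iot K w := by
  simp only [iot_eq, Complex.add_re, Complex.add_im]; module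

lemma iot_smul (K : Quaternion ℝ) (c : ℝ) (z : ℂ) : iot K (c * z) = c • iot K z := by
  simp only [iot_eq, Complex.re_ofReal_mul, Complex.im_ofReal_mul]; module

lemma iot_neg (K : Quaternion ℝ) (z : ℂ) : iot K (-z) = - iot K z := by
  simp only [iot_eq, Complex.neg_re, Complex.neg_im]; module

lemma iot_sub (K : Quaternion ℝ) (z w : ℂ) : iot K (z - w) = iot K z - iot K w := by
  simp only [iot_eq, Complex.sub_re, Complex.sub_im]; module

lemma iot_mul {K : Quaternion ℝ} (hK : K ∈ USphere) (z w : ℂ) :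
    iot K (z * w) = iot K z * iot K w := by
  simp only [iot_eq, Complex.mul_re, Complex.mul_im, add_mul, mul_add, smul_mul_assoc,
    mul_smul_comm, one_mul, mul_one, usphere_mul hK]
  module

lemma iot_pow {K : Quaternion ℝ} (hK : K ∈ USphere) (z : ℂ) (n : ℕ) :
    iot K z ^ n = iot K (z ^ n) := by
  induction n with
  | zero => simp [iot]
  | succ n ih => rw [pow_succ, pow_succ, iot_mul hK, ih]

lemma iot_cont (K : Quaternion ℝ) : Continuous (iot K) := by
  have : iot K = fun z => z.re • (1 : Quaternion ℝ) + z.im • K := funext (iot_eq K)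
  rw [this]; fun_prop

/-- the embedding as a continuous linear map -/
noncomputable def iotL (K : Quaternion ℝ) : ℂ →L[ℝ] Quaternion ℝ :=
  { toFun := iot K
    map_add' := iot_add K
    map_smul' := fun c z => by rw [Complex.real_smul, iot_smul]; rfl
    cont := iot_cont K }

lemma iotL_apply (K : Quaternion ℝ) (z : ℂ) : iotL K z = iot K z := rfl

section Alg
variable {I J : Quaternion ℝ}

lemma J_iot (hIJ : I * J = -(J * I)) (z : ℂ) : J * iot I z = iot I (star z) * J := by
  simp only [iot_eq, mul_add, add_mul, smul_mul_assoc, mul_smul_comm, one_mul, mul_one, hIJ,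
    Complex.star_def, Complex.conj_re, Complex.conj_im]
  module

/-- pairs -/
noncomputable def Phi (I J : Quaternion ℝ) (x y : ℂ) : Quaternion ℝ := iot I x + iot I y * J

lemma Phi_mul (hI : I ∈ USphere) (hJ : J ∈ USphere) (hIJ : I * J = -(J * I)) (x y z w : ℂ) :
    Phi I J x y * Phi I J z w = Phi I J (x * z - y * star w) (x * w + y * star z) := by
  unfold Phi
  rw [iot_sub, iot_add, iot_mul hI, iot_mul hI, iot_mul hI, iot_mul hI]
  have h1 : iot I y * J * iot I z = iot I y * iot I (star z) * J := by
    rw [mul_assoc, J_iot hIJ, mul_assoc]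
  have h2 : iot I y * J * (iot I w * J) = - (iot I y * iot I (star w)) := by
    rw [mul_assoc, ← mul_assoc J, J_iot hIJ, mul_assoc _ J J, usphere_mul hJ]
    simp
  rw [add_mul, mul_add, mul_add, h1, h2, add_mul, mul_assoc (iot I x)]
  abel

lemma Phi_star (hI : I ∈ USphere) (hJ : J ∈ USphere) (hIJ : I * J = -(J * I)) (x y : ℂ) :
    star (Phi I J x y) = Phi I J (star x) (-y) := by
  unfold Phi
  have h : ∀ z, star (iot I z) = iot I (star z) := by
    intro z
    simp only [iot_eq, star_add, Quaternion.star_smul, usphere_star hI, star_one,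
      Complex.star_def, Complex.conj_re, Complex.conj_im]
    module
  rw [star_add, star_mul, h, h, usphere_star hJ, neg_mul, J_iot hIJ, iot_neg, star_star, neg_mul]

lemma IJ_re (hIJ : I * J = -(J * I)) : (I * J).re = 0 := by
  have h1 := congrArg (fun q : Quaternion ℝ => q.re) hIJ
  simp only [Quaternion.re_mul, Quaternion.re_neg] at h1 ⊢
  linarith

lemma Phi_re (hI : I ∈ USphere) (hJ : J ∈ USphere) (hIJ : I * J = -(J * I)) (x y : ℂ) :
    (Phi I J x y).re = x.re := by
  unfold Phi
  simp only [iot_eq, add_mul, smul_mul_assoc, one_mul, Quaternion.re_add, Quaternion.re_smul,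
    Quaternion.re_one, ((usphere_iff I).1 hI).1, ((usphere_iff J).1 hJ).1, IJ_re hIJ]
  simp

lemma Phi_normSq (hI : I ∈ USphere) (hJ : J ∈ USphere) (hIJ : I * J = -(J * I)) (x y : ℂ) :
    ‖Phi I J x y‖ ^ 2 = ‖x‖ ^ 2 + ‖y‖ ^ 2 := by
  rw [sq, ← Quaternion.normSq_eq_norm_mul_self, Quaternion.normSq_def, Phi_star hI hJ hIJ,
    Phi_mul hI hJ hIJ, Phi_re hI hJ hIJ, Complex.sq_norm, Complex.sq_norm, Complex.normSq_apply,
    Complex.normSq_apply]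
  simp

lemma Phi_add (x y z w : ℂ) : Phi I J x y + Phi I J z w = Phi I J (x + z) (y + w) := by
  unfold Phi; rw [iot_add, iot_add, add_mul]; abel

lemma Phi_sub (x y z w : ℂ) : Phi I J x y - Phi I J z w = Phi I J (x - z) (y - w) := by
  unfold Phi; rw [iot_sub, iot_sub, sub_mul]; abel

lemma Phi_I : I = Phi I J Complex.I 0 := by simp [Phi, iot]
lemma Phi_J : J = Phi I J 0 1 := by simp [Phi, iot]
lemma Phi_IJ : I * J = Phi I J 0 Complex.I := by simp [Phi, iot]

/-- representation formula -/
noncomputable def Tf (I K u v : Quaternion ℝ) : Quaternion ℝ :=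
  ((1 / 2 : ℝ) • (1 - K * I)) * u + ((1 / 2 : ℝ) • (1 + K * I)) * v

lemma Tf_normSq (hI : I ∈ USphere) {K : Quaternion ℝ} (hK : K ∈ USphere) (u v : Quaternion ℝ) :
    ‖Tf I K u v‖ ^ 2 = (1 / 2) * (‖u‖ ^ 2 + ‖v‖ ^ 2)
      - (1 / 2) * ((u + v) * star (u - v) * I * K).re := by
  have e : Tf I K u v = (1 / 2 : ℝ) • ((u + v) - K * I * (u - v)) := by
    unfold Tf
    simp only [smul_mul_assoc, sub_mul, add_mul, mul_sub, one_mul]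
    module
  have ns : ∀ x y : Quaternion ℝ, ‖x - y‖ ^ 2 = ‖x‖ ^ 2 + ‖y‖ ^ 2 - 2 * (x * star y).re := by
    intro x y
    have := norm_sub_sq_real x y
    rw [Quaternion.inner_def] at this
    linarith
  have pl : ‖u + v‖ ^ 2 + ‖u - v‖ ^ 2 = 2 * (‖u‖ ^ 2 + ‖v‖ ^ 2) := by
    have := parallelogram_law_with_norm ℝ u v
    nlinarith
  rw [e, norm_smul, mul_pow, ns, norm_mul, norm_mul, usphere_norm hI, usphere_norm hK, star_mul,
    star_mul, usphere_star hI, usphere_star hK]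
  have : (u + v) * (star (u - v) * (-I * -K)) = (u + v) * star (u - v) * I * K := by
    rw [neg_mul_neg]; simp only [mul_assoc]
  rw [this]
  norm_num
  linarith

lemma m_formula (hI : I ∈ USphere) (hJ : J ∈ USphere) (hIJ : I * J = -(J * I)) (F G F' G' : ℂ) :
    (Phi I J F G + Phi I J F' G') * star (Phi I J F G - Phi I J F' G') * I =
      Phi I J (((F + F') * star (F - F') + (G + G') * star (G - G')) * Complex.I)
        (2 * Complex.I * (F' * G - F * G')) := by
  rw [Phi_add, Phi_sub, Phi_star hI hJ hIJ, Phi_mul hI hJ hIJ]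
  have hq : ∀ Q, Q * I = Q * Phi I J Complex.I 0 := fun Q => by rw [← Phi_I]
  rw [hq, Phi_mul hI hJ hIJ]
  congr 1
  · simp; ring
  · simp; ring

lemma alg_forward (hI : I ∈ USphere) (hJ : J ∈ USphere) (hIJ : I * J = -(J * I)) (F G F' G' : ℂ)
    (h1 : ‖F‖ ^ 2 + ‖G‖ ^ 2 = 1) (h2 : ‖F'‖ ^ 2 + ‖G'‖ ^ 2 = 1) (h3 : F * G' = F' * G)
    {K : Quaternion ℝ} (hK : K ∈ USphere) : ‖Tf I K (Phi I J F G) (Phi I J F' G')‖ = 1 := by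
  have h := Tf_normSq hI hK (Phi I J F G) (Phi I J F' G')
  rw [m_formula hI hJ hIJ, Phi_normSq hI hJ hIJ, Phi_normSq hI hJ hIJ, h1, h2, h3, sub_self,
    mul_zero] at h
  set X := ((F + F') * star (F - F') + (G + G') * star (G - G')) * Complex.I with hX
  have hXi : X.im = 0 := by
    rw [Complex.sq_norm, Complex.sq_norm, Complex.normSq_apply, Complex.normSq_apply] at h1 h2
    simp [hX]
    linarith
  have : (Phi I J X 0 * K).re = 0 := by
    have : Phi I J X 0 = X.re • (1 : Quaternion ℝ) := by simp [Phi, iot_eq, hXi]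
    rw [this, smul_mul_assoc, one_mul, Quaternion.re_smul, ((usphere_iff K).1 hK).1, smul_zero]
  rw [this] at h
  norm_num at h
  rcases h with h | h
  · exact h
  · linarith [norm_nonneg (Tf I K (Phi I J F G) (Phi I J F' G'))]

lemma IJ_mem (hI : I ∈ USphere) (hJ : J ∈ USphere) (hIJ : I * J = -(J * I)) :
    I * J ∈ USphere := by
  change (I * J) ^ 2 = -1
  rw [sq]
  nth_rewrite 2 [hIJ]
  rw [mul_neg, mul_assoc, ← mul_assoc J J, usphere_mul hJ]
  simp [usphere_mul hI]

lemma usphere_neg_mem (hI : I ∈ USphere) : -I ∈ USphere := by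
  change (-I) ^ 2 = -1
  rw [neg_sq]; exact hI

lemma alg_backward (hI : I ∈ USphere) (hJ : J ∈ USphere) (hIJ : I * J = -(J * I)) (F G F' G' : ℂ)
    (h1 : ‖Tf I I (Phi I J F G) (Phi I J F' G')‖ = 1)
    (h2 : ‖Tf I (-I) (Phi I J F G) (Phi I J F' G')‖ = 1)
    (h3 : ‖Tf I J (Phi I J F G) (Phi I J F' G')‖ = 1)
    (h4 : ‖Tf I (I * J) (Phi I J F G) (Phi I J F' G')‖ = 1) :
    ‖F‖ ^ 2 + ‖G‖ ^ 2 = 1 ∧ F * G' = F' * G := by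
  have e1 : ∀ u v, Tf I I u v = u := by
    intro u v; unfold Tf; rw [usphere_mul hI]; norm_num
    rw [two_mul, ← two_smul ℝ, smul_smul]; norm_num
  have e2 : ∀ u v, Tf I (-I) u v = v := by
    intro u v; unfold Tf; rw [neg_mul, usphere_mul hI]; norm_num
    rw [two_mul, ← two_smul ℝ, smul_smul]; norm_num
  rw [e1] at h1
  rw [e2] at h2
  have n1 := Phi_normSq hI hJ hIJ F G
  rw [h1] at n1
  refine ⟨by linarith, ?_⟩
  have k3 := Tf_normSq hI hJ (Phi I J F G) (Phi I J F' G')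
  have k4 := Tf_normSq hI (IJ_mem hI hJ hIJ) (Phi I J F G) (Phi I J F' G')
  rw [h3, h1, h2, m_formula hI hJ hIJ] at k3
  rw [h4, h1, h2, m_formula hI hJ hIJ] at k4
  set X := ((F + F') * star (F - F') + (G + G') * star (G - G')) * Complex.I
  have r3 : (Phi I J X (2 * Complex.I * (F' * G - F * G')) * J).re = 0 := by linarith
  have r4 : (Phi I J X (2 * Complex.I * (F' * G - F * G')) * (I * J)).re = 0 := by linarith
  have q3 : Phi I J X (2 * Complex.I * (F' * G - F * G')) * J =
    Phi I J X (2 * Complex.I * (F' * G - F * G')) * Phi I J 0 1 := by rw [← Phi_J]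
  rw [q3, Phi_mul hI hJ hIJ, Phi_re hI hJ hIJ] at r3
  have q4 : Phi I J X (2 * Complex.I * (F' * G - F * G')) * (I * J) =
    Phi I J X (2 * Complex.I * (F' * G - F * G')) * Phi I J 0 Complex.I := by rw [← Phi_IJ]
  rw [q4, Phi_mul hI hJ hIJ, Phi_re hI hJ hIJ] at r4
  have : F' * G - F * G' = 0 := by
    apply Complex.ext
    · simp at r3 r4 ⊢
      linarith
    · simp at r3 r4 ⊢
      linarith
  linear_combination -this

end Alg


lemma ch2_summable {A : ℕ → ℂ} (hA : CMemH2 A) {z : ℂ} (hz : ‖z‖ < 1) :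
    Summable (fun n => z ^ n * A n) := by
  have hb : ∃ C : ℝ, ∀ n, ‖A n‖ ≤ C := by
    have ht : Tendsto (fun n => ‖A n‖ ^ 2) atTop (𝓝 0) := Summable.tendsto_atTop_zero hA
    obtain ⟨C, hC⟩ := ht.bddAbove_range
    refine ⟨C + 1, fun n => ?_⟩
    have := hC ⟨n, rfl⟩
    simp only at this
    nlinarith [sq_nonneg (‖A n‖ - 1), norm_nonneg (A n)]
  obtain ⟨C, hC⟩ := hb
  refine Summable.of_norm_bounded (g := fun n => ‖z‖ ^ n * C) ?_ ?_
  · exact (summable_geometric_of_lt_one (norm_nonneg z) hz).mul_right C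
  · intro n
    rw [norm_mul, norm_pow]
    exact mul_le_mul_of_nonneg_left (hC n) (by positivity)

section Ev
variable {I J : Quaternion ℝ}

lemma iot_rep (hI : I ∈ USphere) (K : Quaternion ℝ) (w : ℂ) :
    iot K w = ((1 / 2 : ℝ) • (1 - K * I)) * iot I w
      + ((1 / 2 : ℝ) • (1 + K * I)) * iot I (star w) := by
  have h : K * I * I = -K := by rw [mul_assoc, usphere_mul hI]; simp
  simp only [iot_eq, Complex.star_def, Complex.conj_re, Complex.conj_im, smul_mul_assoc, mul_add,
    sub_mul, add_mul, mul_smul_comm, one_mul, mul_one, h]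
  module

lemma iot_mul_Phi (hI : I ∈ USphere) (w x y : ℂ) :
    iot I w * Phi I J x y = Phi I J (w * x) (w * y) := by
  unfold Phi; rw [mul_add, iot_mul hI, iot_mul hI, mul_assoc]

lemma Phi_hasSum {x y : ℕ → ℂ} {X Y : ℂ} (hx : HasSum x X) (hy : HasSum y Y) :
    HasSum (fun n => Phi I J (x n) (y n)) (Phi I J X Y) := by
  have h1 : HasSum (fun n => iot I (x n)) (iot I X) := hx.mapL (iotL I)
  have h2 : HasSum (fun n => iot I (y n)) (iot I Y) := hy.mapL (iotL I)
  exact h1.add (h2.mul_right J)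

lemma evalS_eq (hI : I ∈ USphere) {a : ℕ → Quaternion ℝ} {A B : ℕ → ℂ}
    (hA : CMemH2 A) (hB : CMemH2 B) (hs : ∀ n, a n = Phi I J (A n) (B n))
    {K : Quaternion ℝ} (hK : K ∈ USphere) {z : ℂ} (hz : ‖z‖ < 1) :
    evalS a (iot K z) = Tf I K (Phi I J (cEval A z) (cEval B z))
      (Phi I J (cEval A (star z)) (cEval B (star z))) := by
  have hz' : ‖star z‖ < 1 := by rwa [norm_star]
  have h1 := Phi_hasSum (I := I) (J := J) (ch2_summable hA hz).hasSum (ch2_summable hB hz).hasSum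
  have h2 := Phi_hasSum (I := I) (J := J) (ch2_summable hA hz').hasSum (ch2_summable hB hz').hasSum
  have h3 := (h1.mul_left ((1 / 2 : ℝ) • (1 - K * I))).add
    (h2.mul_left ((1 / 2 : ℝ) • (1 + K * I)))
  unfold evalS
  rw [← h3.tsum_eq.trans (show _ = Tf I K (Phi I J (cEval A z) (cEval B z))
      (Phi I J (cEval A (star z)) (cEval B (star z))) from rfl)]
  congr 1
  ext1 n
  rw [hs, iot_pow hK, iot_rep hI, add_mul, mul_assoc, mul_assoc, iot_mul_Phi hI, iot_mul_Phi hI,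
    star_pow]

lemma iot_norm {K : Quaternion ℝ} (hK : K ∈ USphere) (z : ℂ) : ‖iot K z‖ = ‖z‖ := by
  have h : ‖iot K z‖ ^ 2 = ‖z‖ ^ 2 := by
    have := (usphere_iff K).1 hK
    rw [sq, ← Quaternion.normSq_eq_norm_mul_self, Quaternion.normSq_def', Complex.sq_norm,
      Complex.normSq_apply]
    simp only [iot, Quaternion.re_add, Quaternion.imI_add, Quaternion.imJ_add, Quaternion.imK_add,
      Quaternion.re_smul, Quaternion.imI_smul, Quaternion.imJ_smul, Quaternion.imK_smul,
      Quaternion.re_coe, Quaternion.imI_coe, Quaternion.imJ_coe, Quaternion.imK_coe, this.1,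
      smul_eq_mul]
    linear_combination z.im ^ 2 * this.2
  exact (sq_eq_sq₀ (norm_nonneg _) (norm_nonneg _)).1 h

lemma exists_iot (hI : I ∈ USphere) (q : Quaternion ℝ) : ∃ K ∈ USphere, ∃ z : ℂ, q = iot K z := by
  by_cases h : q.imI ^ 2 + q.imJ ^ 2 + q.imK ^ 2 = 0
  · refine ⟨I, hI, ⟨q.re, 0⟩, ?_⟩
    have h1 : q.imI = 0 := by nlinarith [sq_nonneg q.imI, sq_nonneg q.imJ, sq_nonneg q.imK]
    have h2 : q.imJ = 0 := by nlinarith [sq_nonneg q.imI, sq_nonneg q.imJ, sq_nonneg q.imK]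
    have h3 : q.imK = 0 := by nlinarith [sq_nonneg q.imI, sq_nonneg q.imJ, sq_nonneg q.imK]
    apply Quaternion.ext <;> simp [iot, h1, h2, h3]
  · set s := Real.sqrt (q.imI ^ 2 + q.imJ ^ 2 + q.imK ^ 2) with hs
    have h0 : 0 ≤ q.imI ^ 2 + q.imJ ^ 2 + q.imK ^ 2 := by positivity
    have hs2 : s ^ 2 = q.imI ^ 2 + q.imJ ^ 2 + q.imK ^ 2 := Real.sq_sqrt h0
    have hs0 : s ≠ 0 := fun h' => h (by rw [← hs2, h']; simp)
    refine ⟨s⁻¹ • q.im, ?_, ⟨q.re, s⟩, ?_⟩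
    · refine (usphere_iff _).2 ⟨?_, ?_⟩
      · simp
      · simp only [Quaternion.imI_smul, Quaternion.imJ_smul, Quaternion.imK_smul,
          Quaternion.imI_im, Quaternion.imJ_im, Quaternion.imK_im, smul_eq_mul, mul_pow]
        rw [← mul_add, ← mul_add, ← hs2, ← mul_pow, inv_mul_cancel₀ hs0, one_pow]
    · simp only [iot, smul_smul]
      rw [mul_inv_cancel₀ hs0, one_smul, Quaternion.re_add_im]

lemma smul_ptOn (K : Quaternion ℝ) (r t : ℝ) :
    (r : Quaternion ℝ) * ptOn K t = iot K (r * Complex.exp (t * Complex.I)) := by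
  have : ptOn K t = iot K (Complex.exp (t * Complex.I)) := by
    simp [ptOn, iot, Complex.exp_ofReal_mul_I_re, Complex.exp_ofReal_mul_I_im]
  rw [this, iot_smul, Quaternion.coe_mul_eq_smul]

lemma star_polar (r t : ℝ) : star ((r : ℂ) * Complex.exp (t * Complex.I)) =
    r * Complex.exp (((-t : ℝ) : ℂ) * Complex.I) := by
  simp [← Complex.exp_conj]

lemma norm_polar {r : ℝ} (h0 : 0 ≤ r) (t : ℝ) : ‖(r : ℂ) * Complex.exp (t * Complex.I)‖ = r := by
  rw [norm_mul, Complex.norm_exp_ofReal_mul_I, mul_one, Complex.norm_real, Real.norm_of_nonneg h0]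

lemma evalS_polar (hI : I ∈ USphere) {a : ℕ → Quaternion ℝ} {A B : ℕ → ℂ}
    (hA : CMemH2 A) (hB : CMemH2 B) (hs : ∀ n, a n = Phi I J (A n) (B n))
    {K : Quaternion ℝ} (hK : K ∈ USphere) {r : ℝ} (h0 : 0 ≤ r) (h1 : r < 1) (t : ℝ) :
    evalS a (iot K (r * Complex.exp (t * Complex.I))) =
      Tf I K (Phi I J (cEval A (r * Complex.exp (t * Complex.I)))
        (cEval B (r * Complex.exp (t * Complex.I))))
      (Phi I J (cEval A (r * Complex.exp (((-t : ℝ) : ℂ) * Complex.I)))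
        (cEval B (r * Complex.exp (((-t : ℝ) : ℂ) * Complex.I)))) := by
  rw [evalS_eq hI hA hB hs hK (by rwa [norm_polar h0]), star_polar]

lemma Phi_cont : Continuous (fun p : ℂ × ℂ => Phi I J p.1 p.2) := by
  unfold Phi
  exact ((iot_cont I).comp continuous_fst).add
    (((iot_cont I).comp continuous_snd).mul continuous_const)

lemma cBdval_eq {A : ℕ → ℂ} {z L : ℂ}
    (h : Tendsto (fun r : ℝ => cEval A (r * z)) (𝓝[<] 1) (𝓝 L)) : cBdval A z = L := by
  have h' : ∃ L, Tendsto (fun r : ℝ => cEval A ((r : ℂ) * z)) (𝓝[<] (1 : ℝ)) (𝓝 L) := ⟨L, h⟩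
  unfold cBdval
  rw [dif_pos h']
  exact tendsto_nhds_unique h'.choose_spec h

lemma bdval_eq {a : ℕ → Quaternion ℝ} {q L : Quaternion ℝ}
    (h : Tendsto (fun r : ℝ => evalS a ((r : Quaternion ℝ) * q)) (𝓝[<] 1) (𝓝 L)) :
    bdval a q = L := by
  have h' : ∃ L, Tendsto (fun r : ℝ => evalS a ((r : Quaternion ℝ) * q)) (𝓝[<] (1 : ℝ)) (𝓝 L) :=
    ⟨L, h⟩
  unfold bdval
  rw [dif_pos h']
  exact tendsto_nhds_unique h'.choose_spec h

lemma bdval_good (hI : I ∈ USphere) {a : ℕ → Quaternion ℝ} {A B : ℕ → ℂ}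
    (hA : CMemH2 A) (hB : CMemH2 B) (hs : ∀ n, a n = Phi I J (A n) (B n))
    {K : Quaternion ℝ} (hK : K ∈ USphere) {t : ℝ} {F G F' G' : ℂ}
    (h1 : Tendsto (fun r : ℝ => cEval A (r * Complex.exp (t * Complex.I))) (𝓝[<] 1) (𝓝 F))
    (h2 : Tendsto (fun r : ℝ => cEval B (r * Complex.exp (t * Complex.I))) (𝓝[<] 1) (𝓝 G))
    (h3 : Tendsto (fun r : ℝ => cEval A (r * Complex.exp (((-t : ℝ) : ℂ) * Complex.I)))
      (𝓝[<] 1) (𝓝 F'))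
    (h4 : Tendsto (fun r : ℝ => cEval B (r * Complex.exp (((-t : ℝ) : ℂ) * Complex.I)))
      (𝓝[<] 1) (𝓝 G')) :
    bdval a (ptOn K t) = Tf I K (Phi I J F G) (Phi I J F' G') := by
  apply bdval_eq
  have e : (fun r : ℝ => Tf I K (Phi I J (cEval A (r * Complex.exp (t * Complex.I)))
        (cEval B (r * Complex.exp (t * Complex.I))))
      (Phi I J (cEval A (r * Complex.exp (((-t : ℝ) : ℂ) * Complex.I)))
        (cEval B (r * Complex.exp (((-t : ℝ) : ℂ) * Complex.I)))))
      =ᶠ[𝓝[<] 1] (fun r : ℝ => evalS a ((r : Quaternion ℝ) * ptOn K t)) := by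
    filter_upwards [Ioo_mem_nhdsLT (zero_lt_one (α := ℝ))] with r hr
    rw [smul_ptOn, evalS_polar hI hA hB hs hK hr.1.le hr.2]
  refine Tendsto.congr' e ?_
  have p1 := (Phi_cont (I := I) (J := J)).continuousAt.tendsto.comp (h1.prodMk_nhds h2)
  have p2 := (Phi_cont (I := I) (J := J)).continuousAt.tendsto.comp (h3.prodMk_nhds h4)
  exact (p1.const_mul _).add (p2.const_mul _)

lemma Tf_cont (u v : Quaternion ℝ) : Continuous (fun K => ‖Tf I K u v‖) := by
  unfold Tf; fun_prop

end Ev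


lemma ae_shift {P : ℝ → Prop} (h : ∀ᵐ t : ℝ, P t) (c : ℝ) : ∀ᵐ t : ℝ, P (t + c) :=
  (measurePreserving_add_right volume c).quasiMeasurePreserving.ae h

lemma ae_neg {P : ℝ → Prop} (h : ∀ᵐ t : ℝ, P t) : ∀ᵐ t : ℝ, P (-t) :=
  (Measure.measurePreserving_neg volume).quasiMeasurePreserving.ae h

lemma ae_periodic {P : ℝ → Prop} (hP : ∀ (t : ℝ) (n : ℤ), P (t + n * (2 * Real.pi)) → P t)
    (h : ∀ᵐ t ∂volume.restrict (Set.Ico 0 (2 * Real.pi)), P t) : ∀ᵐ t : ℝ, P t := by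
  rw [ae_restrict_iff' measurableSet_Ico] at h
  have h2 : ∀ᵐ t : ℝ, ∀ n : ℤ, t + n * (2 * Real.pi) ∈ Set.Ico 0 (2 * Real.pi) →
      P (t + n * (2 * Real.pi)) := by
    rw [ae_all_iff]
    intro n
    exact ae_shift h _
  filter_upwards [h2] with t ht
  obtain ⟨n, hn, -⟩ := existsUnique_add_zsmul_mem_Ico Real.two_pi_pos t 0
  simp only [zsmul_eq_mul, zero_add] at hn
  exact hP t n (ht n hn)

lemma exp_shift (t : ℝ) (n : ℤ) : Complex.exp (((t + n * (2 * Real.pi) : ℝ) : ℂ) * Complex.I) =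
    Complex.exp (t * Complex.I) := by
  rw [Complex.exp_eq_exp_iff_exists_int]
  exact ⟨n, by push_cast; ring⟩

lemma circ_to {Q : ℂ → Prop} (h : ∀ᵐ z ∂circleM, Q z) :
    ∀ᵐ t : ℝ, Q (Complex.exp (t * Complex.I)) := by
  apply ae_periodic
  · intro t n ht
    rwa [exp_shift] at ht
  · exact ae_of_ae_map (by fun_prop) h

lemma circ_from {Q : ℂ → Prop} (h : ∀ᵐ t : ℝ, Q (Complex.exp (t * Complex.I))) :
    ∀ᵐ z ∂circleM, Q z := by
  set N := toMeasurable volume {t : ℝ | ¬ Q (Complex.exp (t * Complex.I))} with hN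
  have hN0 : volume N = 0 := by rw [hN, measure_toMeasurable]; exact h
  have hNm : MeasurableSet N := measurableSet_toMeasurable _ _
  have key : ∀ᵐ z ∂circleM, ‖z‖ = 1 ∧ Complex.arg z ∉ N := by
    unfold circleM
    rw [ae_map_iff (by fun_prop)]
    · apply ae_restrict_of_ae
      have h0 : ∀ᵐ t : ℝ, ∀ n : ℤ, t + n * (2 * Real.pi) ∉ N := by
        rw [ae_all_iff]; intro n
        exact ae_shift (P := fun t => t ∉ N) (measure_eq_zero_iff_ae_notMem.1 hN0) _
      filter_upwards [h0] with t ht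
      refine ⟨Complex.norm_exp_ofReal_mul_I t, ?_⟩
      have e : Complex.exp (Complex.arg (Complex.exp (t * Complex.I)) * Complex.I) =
          Complex.exp (t * Complex.I) := by
        have := Complex.norm_mul_exp_arg_mul_I (Complex.exp (t * Complex.I))
        rwa [Complex.norm_exp_ofReal_mul_I, Complex.ofReal_one, one_mul] at this
      obtain ⟨n, hn⟩ := Complex.exp_eq_exp_iff_exists_int.1 e
      have : Complex.arg (Complex.exp (t * Complex.I)) = t + n * (2 * Real.pi) := by
        have h3 : ((Complex.arg (Complex.exp (t * Complex.I)) : ℝ) : ℂ) * Complex.I =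
          ((t + n * (2 * Real.pi) : ℝ) : ℂ) * Complex.I := by
            rw [hn]; push_cast; ring
        exact_mod_cast mul_right_cancel₀ Complex.I_ne_zero h3
      rw [this]; exact ht n
    · exact (measurableSet_eq_fun measurable_norm measurable_const).inter
        (Complex.measurable_arg hNm).compl
  filter_upwards [key] with z hz
  by_contra hq
  apply hz.2
  apply subset_toMeasurable
  change ¬ Q _
  have := Complex.norm_mul_exp_arg_mul_I z
  rw [hz.1, Complex.ofReal_one, one_mul] at this
  rwa [this]

lemma usphere_closed : IsClosed USphere :=
  isClosed_eq (by fun_prop) continuous_const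

lemma usphere_meas : MeasurableSet USphere := usphere_closed.measurableSet

/-- spherical coordinates -/
noncomputable def sphC (p : Fin 2 → ℝ) : Quaternion ℝ :=
  Real.cos (p 0) • (⟨0, 1, 0, 0⟩ : Quaternion ℝ) +
    ((Real.sin (p 0) * Real.cos (p 1)) • (⟨0, 0, 1, 0⟩ : Quaternion ℝ) +
     (Real.sin (p 0) * Real.sin (p 1)) • (⟨0, 0, 0, 1⟩ : Quaternion ℝ))

lemma sphC_lip : ∃ C, LipschitzOnWith C sphC (Set.Icc (fun _ => -Real.pi) (fun _ => Real.pi)) := by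
  have hc : ContDiff ℝ 1 sphC := by
    unfold sphC
    fun_prop
  exact hc.contDiffOn.exists_lipschitzOnWith one_ne_zero (convex_Icc _ _) isCompact_Icc

lemma usphere_sub : USphere ⊆ sphC '' (Set.Icc (fun _ => -Real.pi) (fun _ => Real.pi)) := by
  intro K hK
  obtain ⟨h0, h1⟩ := (usphere_iff K).1 hK
  set z : ℂ := ⟨K.imJ, K.imK⟩ with hz
  have hb : -1 ≤ K.imI ∧ K.imI ≤ 1 := by
    constructor <;> nlinarith [sq_nonneg K.imJ, sq_nonneg K.imK]
  have hn : ‖z‖ = Real.sin (Real.arccos K.imI) := by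
    rw [Real.sin_arccos, Complex.norm_def]
    congr 1
    simp [hz, Complex.normSq_apply]
    linarith
  refine ⟨![Real.arccos K.imI, Complex.arg z], ⟨?_, ?_⟩, ?_⟩
  · intro i
    fin_cases i
    · simp; linarith [Real.arccos_nonneg K.imI, Real.pi_pos]
    · simpa using (Complex.neg_pi_lt_arg z).le
  · intro i
    fin_cases i
    · simpa using Real.arccos_le_pi K.imI
    · simpa using Complex.arg_le_pi z
  · have e1 := Complex.norm_mul_cos_arg z
    have e2 := Complex.norm_mul_sin_arg z
    rw [hn] at e1 e2
    unfold sphC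
    simp only [Matrix.cons_val_zero, Matrix.cons_val_one]
    rw [e1, e2, Real.cos_arccos hb.1 hb.2]
    apply Quaternion.ext <;> simp [hz, h0]

lemma usphere_fin : μH[2] USphere < ∞ := by
  obtain ⟨C, hC⟩ := sphC_lip
  refine lt_of_le_of_lt (measure_mono usphere_sub) ?_
  refine lt_of_le_of_lt (hC.hausdorffMeasure_image_le zero_le_two) ?_
  have h2 : (μH[2] : Measure (Fin 2 → ℝ)) = volume := by
    have := hausdorffMeasure_pi_real (ι := Fin 2)
    simpa using this
  rw [h2]
  refine ENNReal.mul_lt_top ?_ (isCompact_Icc.measure_lt_top)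
  exact ENNReal.rpow_lt_top_of_nonneg zero_le_two ENNReal.coe_ne_top

lemma sph_dense {K0 e e' : Quaternion ℝ} (h0 : K0 ∈ USphere) (he : e ∈ USphere) (he' : e' ∈ USphere)
    (h1 : K0 * e = -(e * K0)) (h2 : K0 * e' = -(e' * K0)) (h3 : e * e' = -(e' * e))
    {P : Quaternion ℝ → Prop} (h : ∀ᵐ K ∂sphMeasure, P K) {ε : ℝ} (hε : 0 < ε) :
    ∃ K ∈ USphere, P K ∧ ‖K - K0‖ < ε := by
  by_contra! hcon
  have hz : μH[2] ({K | ‖K - K0‖ < ε} ∩ USphere) = 0 := by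
    have hs : sphMeasure {K | ¬ P K} = 0 := h
    unfold sphMeasure at hs
    rw [Measure.smul_apply, smul_eq_mul, mul_eq_zero] at hs
    rcases hs with hs | hs
    · exact absurd hs (ENNReal.inv_ne_zero.2 usphere_fin.ne)
    · rw [Measure.restrict_apply' usphere_meas] at hs
      refine measure_mono_null ?_ hs
      rintro K ⟨hK, hK'⟩
      exact ⟨fun hp => absurd hK (not_lt.2 (hcon K hK' hp)), hK'⟩
  set pr : Quaternion ℝ → (Fin 2 → ℝ) := fun q => ![-(q * e).re, -(q * e').re] with hpr
  have hlip : LipschitzWith 1 pr := by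
    apply LipschitzWith.of_dist_le_mul
    intro x y
    rw [NNReal.coe_one, one_mul, dist_pi_le_iff dist_nonneg]
    have hre : ∀ q : Quaternion ℝ, |q.re| ≤ ‖q‖ := by
      intro q
      apply abs_le_of_sq_le_sq _ (norm_nonneg q)
      rw [sq ‖q‖, ← Quaternion.normSq_eq_norm_mul_self, Quaternion.normSq_def']
      nlinarith [sq_nonneg q.imI, sq_nonneg q.imJ, sq_nonneg q.imK]
    have hd : ∀ f ∈ USphere, dist (-(x * f).re) (-(y * f).re) ≤ dist x y := by
      intro f hf
      rw [dist_neg_neg, Real.dist_eq, dist_eq_norm, ← Quaternion.re_sub, ← sub_mul]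
      refine (hre _).trans ?_
      rw [norm_mul, usphere_norm hf, mul_one]
    intro i
    fin_cases i
    · simpa [hpr] using hd e he
    · simpa [hpr] using hd e' he'
  set kk : (Fin 2 → ℝ) → Quaternion ℝ := fun x =>
    Real.sqrt (1 - (x 0 ^ 2 + x 1 ^ 2)) • K0 + (x 0 • e + x 1 • e') with hkk
  have hkc : Continuous kk := by rw [hkk]; fun_prop
  have hk0 : kk 0 = K0 := by simp [hkk]
  set U : Set (Fin 2 → ℝ) := {x | ‖kk x - K0‖ < ε} ∩ {x | x 0 ^ 2 + x 1 ^ 2 < 1} with hU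
  have hUo : IsOpen U :=
    (isOpen_lt (by fun_prop) continuous_const).inter (isOpen_lt (by fun_prop) continuous_const)
  have hU0 : (0 : Fin 2 → ℝ) ∈ U := by
    refine ⟨?_, ?_⟩
    · simp [hk0, hε]
    · simp
  have hre2 : ∀ x y : Quaternion ℝ, x * y = -(y * x) → (x * y).re = 0 ∧ (y * x).re = 0 := by
    intro x y hxy
    have := IJ_re hxy
    refine ⟨this, ?_⟩
    rw [hxy, Quaternion.re_neg] at this
    linarith
  have hre1 : ∀ f ∈ USphere, (f * f).re = -1 := by
    intro f hf; rw [usphere_mul hf, Quaternion.re_neg, Quaternion.re_one]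
  have hsub : U ⊆ pr '' ({K | ‖K - K0‖ < ε} ∩ USphere) := by
    rintro x ⟨hx1, hx2⟩
    refine ⟨kk x, ⟨hx1, ?_⟩, ?_⟩
    · change (kk x) ^ 2 = -1
      set c := Real.sqrt (1 - (x 0 ^ 2 + x 1 ^ 2)) with hc
      have hc2 : c ^ 2 = 1 - (x 0 ^ 2 + x 1 ^ 2) := Real.sq_sqrt (by
        have : x 0 ^ 2 + x 1 ^ 2 < 1 := hx2
        linarith)
      have : (kk x) ^ 2 = (-(c ^ 2 + (x 0 ^ 2 + x 1 ^ 2))) • (1 : Quaternion ℝ) := by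
        rw [sq]
        simp only [hkk, ← hc, add_mul, mul_add, smul_mul_assoc, mul_smul_comm, usphere_mul h0,
          usphere_mul he, usphere_mul he', h1, h2, h3]
        module
      rw [this, hc2]
      simp
    · ext i
      fin_cases i
      · simp only [hpr, hkk, add_mul, smul_mul_assoc, Quaternion.re_add, Quaternion.re_smul,
          (hre2 _ _ h1).1, hre1 e he, (hre2 _ _ h3).2]
        simp
      · simp only [hpr, hkk, add_mul, smul_mul_assoc, Quaternion.re_add, Quaternion.re_smul,
          (hre2 _ _ h2).1, hre1 e' he', (hre2 _ _ h3).1]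
        simp
  have hpos : 0 < volume U := hUo.measure_pos volume ⟨0, hU0⟩
  have hv : (μH[2] : Measure (Fin 2 → ℝ)) = volume := by
    have := hausdorffMeasure_pi_real (ι := Fin 2)
    simpa using this
  have hle : volume U ≤ 0 := by
    rw [← hv]
    refine (measure_mono hsub).trans ?_
    refine (hlip.lipschitzOnWith.hausdorffMeasure_image_le zero_le_two).trans ?_
    rw [hz, mul_zero]
  exact absurd hle (not_le.2 hpos)

lemma sph_dense_eq {K0 e e' : Quaternion ℝ} (h0 : K0 ∈ USphere) (he : e ∈ USphere)
    (he' : e' ∈ USphere)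
    (h1 : K0 * e = -(e * K0)) (h2 : K0 * e' = -(e' * K0)) (h3 : e * e' = -(e' * e))
    {φ : Quaternion ℝ → ℝ} (hφ : Continuous φ)
    (h : ∀ᵐ K ∂sphMeasure, K ∈ USphere → φ K = 1) : φ K0 = 1 := by
  by_contra hne
  have ho : IsOpen {K | φ K ≠ 1} := isOpen_ne_fun hφ continuous_const
  obtain ⟨ε, hε, hb⟩ := Metric.isOpen_iff.1 ho K0 hne
  obtain ⟨K, hK, hP, hd⟩ := sph_dense h0 he he' h1 h2 h3 h hε
  exact hb (by rwa [Metric.mem_ball, dist_eq_norm]) (hP hK)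

instance sph_finite : IsFiniteMeasure sphMeasure := by
  by_cases h : μH[2] USphere = 0
  · have : sphMeasure = 0 := by
      unfold sphMeasure
      rw [Measure.restrict_eq_zero.2 h, smul_zero]
    rw [this]; infer_instance
  · refine ⟨?_⟩
    unfold sphMeasure
    rw [Measure.smul_apply, smul_eq_mul, Measure.restrict_apply_univ]
    exact ENNReal.mul_lt_top (ENNReal.inv_lt_top.2 (pos_iff_ne_zero.2 h)) usphere_fin

lemma sph_ae_mem : ∀ᵐ K ∂sphMeasure, K ∈ USphere := by
  unfold sphMeasure
  exact Measure.ae_smul_measure (ae_restrict_mem usphere_meas) _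

lemma ptOn_cont : Continuous (fun p : ℝ × Quaternion ℝ => ptOn p.2 p.1) := by
  have : (fun p : ℝ × Quaternion ℝ => ptOn p.2 p.1) = fun p : ℝ × Quaternion ℝ =>
      Real.cos p.1 • (1 : Quaternion ℝ) + Real.sin p.1 • p.2 := by
    ext1 p
    unfold ptOn
    congr 1
    exact Algebra.algebraMap_eq_smul_one (A := Quaternion ℝ) (Real.cos p.1)
  rw [this]; fun_prop

lemma sigma_to {R : Quaternion ℝ → Prop} (h : ∀ᵐ q ∂SigmaBd, R q) :
    ∀ᵐ t : ℝ, ∀ᵐ K ∂sphMeasure, R (ptOn K t) := by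
  apply ae_periodic
  · intro t n ht
    filter_upwards [ht] with K hK
    unfold ptOn at hK ⊢
    rwa [Real.cos_add_int_mul_two_pi, Real.sin_add_int_mul_two_pi] at hK
  · have h2 : ∀ᵐ q ∂(Measure.map (fun p : ℝ × Quaternion ℝ => ptOn p.2 p.1)
      ((volume.restrict (Set.Ico 0 (2 * Real.pi))).prod sphMeasure)), R q := by
      have hs : SigmaBd {q | ¬ R q} = 0 := h
      unfold SigmaBd at hs
      rw [Measure.smul_apply, smul_eq_mul, mul_eq_zero] at hs
      rcases hs with hs | hs
      · exact absurd hs (ENNReal.inv_ne_zero.2 ENNReal.ofReal_ne_top)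
      · exact hs
    exact Measure.ae_ae_of_ae_prod (ae_of_ae_map ptOn_cont.measurable.aemeasurable h2)

lemma ptOn_iot (K : Quaternion ℝ) (t : ℝ) : ptOn K t = iot K (Complex.exp (t * Complex.I)) := by
  have := smul_ptOn K 1 t
  simpa using this

lemma ptOn_re {K : Quaternion ℝ} (hK : K ∈ USphere) (t : ℝ) : (ptOn K t).re = Real.cos t := by
  simp [ptOn, ((usphere_iff K).1 hK).1]

lemma sigma_from {R : Quaternion ℝ → Prop} {I : Quaternion ℝ} (hI : I ∈ USphere)
    (h : ∀ᵐ t : ℝ, ∀ K ∈ USphere, R (ptOn K t)) : ∀ᵐ q ∂SigmaBd, R q := by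
  set N := toMeasurable volume {t : ℝ | ¬ ∀ K ∈ USphere, R (ptOn K t)} with hN
  have hN0 : volume N = 0 := by rw [hN, measure_toMeasurable]; exact h
  have hNm : MeasurableSet N := measurableSet_toMeasurable _ _
  have hre : Continuous (fun q : Quaternion ℝ => q.re) := Quaternion.continuous_re
  have key : ∀ᵐ q ∂SigmaBd, ‖q‖ = 1 ∧ Real.arccos q.re ∉ N := by
    unfold SigmaBd
    apply Measure.ae_smul_measure
    rw [ae_map_iff ptOn_cont.measurable.aemeasurable]
    · have h0 : ∀ᵐ t : ℝ, ∀ n : ℤ, t + n * (2 * Real.pi) ∉ N := by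
        rw [ae_all_iff]; intro n
        exact ae_shift (P := fun t => t ∉ N) (measure_eq_zero_iff_ae_notMem.1 hN0) _
      have h1 := ae_neg h0
      have h3 : ∀ᵐ t : ℝ, Real.arccos (Real.cos t) ∉ N := by
        filter_upwards [h0, h1] with t ht ht'
        have e : Real.cos (Real.arccos (Real.cos t)) = Real.cos t :=
          Real.cos_arccos (Real.neg_one_le_cos t) (Real.cos_le_one t)
        obtain ⟨k, hk⟩ := Real.cos_eq_cos_iff.1 e.symm
        rcases hk with hk | hk
        · have := ht k
          rwa [show t + k * (2 * Real.pi) = Real.arccos (Real.cos t) by rw [hk]; ring] at this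
        · have := ht' k
          rwa [show -t + k * (2 * Real.pi) = Real.arccos (Real.cos t) by rw [hk]; ring] at this
      have h4 : ∀ᵐ p ∂((volume.restrict (Set.Ico 0 (2 * Real.pi))).prod sphMeasure),
          Real.arccos (Real.cos p.1) ∉ N :=
        Measure.quasiMeasurePreserving_fst.ae (ae_restrict_of_ae h3)
      have h5 : ∀ᵐ p ∂((volume.restrict (Set.Ico 0 (2 * Real.pi))).prod sphMeasure),
          p.2 ∈ USphere :=
        Measure.quasiMeasurePreserving_snd.ae sph_ae_mem
      filter_upwards [h4, h5] with p hp hp'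
      rw [ptOn_re hp', ptOn_iot, iot_norm hp', Complex.norm_exp_ofReal_mul_I]
      exact ⟨rfl, hp⟩
    · exact (measurableSet_eq_fun measurable_norm measurable_const).inter
        ((Real.continuous_arccos.comp hre).measurable hNm).compl
  filter_upwards [key] with q hq
  obtain ⟨hq1, hq2⟩ := hq
  have hgood : ∀ K ∈ USphere, R (ptOn K (Real.arccos q.re)) := by
    by_contra hcon
    exact hq2 (subset_toMeasurable _ _ hcon)
  obtain ⟨K, hK, z, rfl⟩ := exists_iot hI q
  rw [iot_norm hK] at hq1
  have hz := Complex.norm_mul_exp_arg_mul_I z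
  rw [hq1, Complex.ofReal_one, one_mul] at hz
  rw [← hz, ← ptOn_iot] at hgood ⊢
  rw [ptOn_re hK] at hgood
  rcases le_total 0 (Complex.arg z) with h0 | h0
  · rw [Real.arccos_cos h0 (Complex.arg_le_pi z)] at hgood
    exact hgood K hK
  · rw [← Real.cos_neg, Real.arccos_cos (by linarith) (by linarith [Complex.neg_pi_lt_arg z])]
      at hgood
    have := hgood (-K) (usphere_neg_mem hK)
    simpa [ptOn] using this


section Fin
variable {I J : Quaternion ℝ}

lemma pkg_int {r : ℝ} (h0 : 0 ≤ r) (h1 : r < 1) {g : ℝ → ℂ}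
    (hg : ∀ a b, IntervalIntegrable g volume a b) :
    IntervalIntegrable (fun s => (pk r s : ℂ) * g s) volume (-Real.pi) Real.pi :=
  (hg _ _).continuousOn_mul
    (Complex.continuous_ofReal.comp (pk_contDiff h0 h1).continuous).continuousOn

lemma L_int {r : ℝ} (h0 : 0 ≤ r) (h1 : r < 1) {g : ℝ → ℂ}
    (hg : ∀ a b, IntervalIntegrable g volume a b) (L : ℂ →L[ℝ] Quaternion ℝ) {X : ℂ}
    (hX : ∫ s in (-Real.pi)..Real.pi, (pk r s : ℂ) * g s = 2 * Real.pi * X) :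
    IntervalIntegrable (fun s => pk r s • L (g s)) volume (-Real.pi) Real.pi ∧
    ∫ s in (-Real.pi)..Real.pi, pk r s • L (g s) = (2 * Real.pi) • L X := by
  have e : (fun s => pk r s • L (g s)) = fun s => L ((pk r s : ℂ) * g s) := by
    ext1 s
    rw [← L.map_smul, Complex.real_smul]
  have hi := pkg_int h0 h1 hg
  rw [e]
  refine ⟨⟨L.integrable_comp hi.1, L.integrable_comp hi.2⟩, ?_⟩
  rw [L.intervalIntegral_comp_comm hi, hX, ← L.map_smul, Complex.real_smul]
  push_cast
  rfl

lemma shift_int {g : ℝ → ℂ} (hg : ∀ a b, IntervalIntegrable g volume a b) (c : ℝ) :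
    ∀ a b, IntervalIntegrable (fun s => g (c + s)) volume a b := by
  intro a b
  have := (hg (a + c) (b + c)).comp_add_left c
  simpa using this

lemma shift_int' {g : ℝ → ℂ} (hg : ∀ a b, IntervalIntegrable g volume a b) (c : ℝ) :
    ∀ a b, IntervalIntegrable (fun s => g (c - s)) volume a b := by
  intro a b
  have := (hg (c - a) (c - b)).comp_sub_left c
  simpa using this

lemma ball_bound (hI : I ∈ USphere) (hJ : J ∈ USphere) (hIJ : I * J = -(J * I))
    {a : ℕ → Quaternion ℝ} {A B : ℕ → ℂ}
    (hA : CMemH2 A) (hB : CMemH2 B) (hs : ∀ n, a n = Phi I J (A n) (B n)) {f g : ℝ → ℂ}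
    (hf : ∀ a b, IntervalIntegrable f volume a b) (hg : ∀ a b, IntervalIntegrable g volume a b)
    (pf : ∀ r θ : ℝ, 0 ≤ r → r < 1 → ∫ t in (-Real.pi)..Real.pi, (pk r t : ℂ) * f (θ + t) =
     2 * Real.pi * cEval A (r * Complex.exp (θ * Complex.I)))
    (pg : ∀ r θ : ℝ, 0 ≤ r → r < 1 → ∫ t in (-Real.pi)..Real.pi, (pk r t : ℂ) * g (θ + t) =
     2 * Real.pi * cEval B (r * Complex.exp (θ * Complex.I)))
    (hc : ∀ᵐ t : ℝ, ‖f t‖ ^ 2 + ‖g t‖ ^ 2 = 1 ∧ f t * g (-t) = f (-t) * g t)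
    {K : Quaternion ℝ} (hK : K ∈ USphere) {r : ℝ} (h0 : 0 ≤ r) (h1 : r < 1) (t : ℝ) :
    ‖evalS a (iot K (r * Complex.exp (t * Complex.I)))‖ ≤ 1 := by
  have refl : ∀ (φ : ℝ → ℂ), ∫ s in (-Real.pi)..Real.pi, (pk r s : ℂ) * φ (-t - s) =
      ∫ s in (-Real.pi)..Real.pi, (pk r s : ℂ) * φ (-t + s) := by
    intro φ
    have := intervalIntegral.integral_comp_neg (a := -Real.pi) (b := Real.pi)
      (fun s => (pk r s : ℂ) * φ (-t + s))
    rw [neg_neg] at this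
    rw [← this]
    simp only [pk_neg, sub_eq_add_neg]
  set P : Quaternion ℝ := (1 / 2 : ℝ) • (1 - K * I) with hP
  set Q : Quaternion ℝ := (1 / 2 : ℝ) • (1 + K * I) with hQ
  set L1 : ℂ →L[ℝ] Quaternion ℝ := (ContinuousLinearMap.mul ℝ (Quaternion ℝ) P).comp (iotL I)
  set L2 : ℂ →L[ℝ] Quaternion ℝ := (ContinuousLinearMap.mul ℝ (Quaternion ℝ) P).comp
    (((ContinuousLinearMap.mul ℝ (Quaternion ℝ)).flip J).comp (iotL I))
  set L3 : ℂ →L[ℝ] Quaternion ℝ := (ContinuousLinearMap.mul ℝ (Quaternion ℝ) Q).comp (iotL I)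
  set L4 : ℂ →L[ℝ] Quaternion ℝ := (ContinuousLinearMap.mul ℝ (Quaternion ℝ) Q).comp
    (((ContinuousLinearMap.mul ℝ (Quaternion ℝ)).flip J).comp (iotL I))
  have hT : ∀ x y x' y' : ℂ, Tf I K (Phi I J x y) (Phi I J x' y') =
      L1 x + L2 y + (L3 x' + L4 y') := by
    intro x y x' y'
    change P * (iot I x + iot I y * J) + Q * (iot I x' + iot I y' * J) =
      P * iot I x + P * (iot I y * J) + (Q * iot I x' + Q * (iot I y' * J))
    rw [mul_add, mul_add]
  obtain ⟨i1, e1⟩ := L_int h0 h1 (shift_int hf t) L1 (pf r t h0 h1)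
  obtain ⟨i2, e2⟩ := L_int h0 h1 (shift_int hg t) L2 (pg r t h0 h1)
  obtain ⟨i3, e3⟩ := L_int h0 h1 (shift_int' hf (-t)) L3 ((refl f).trans (pf r (-t) h0 h1))
  obtain ⟨i4, e4⟩ := L_int h0 h1 (shift_int' hg (-t)) L4 ((refl g).trans (pg r (-t) h0 h1))
  have main : ∫ s in (-Real.pi)..Real.pi, pk r s • Tf I K (Phi I J (f (t + s)) (g (t + s)))
      (Phi I J (f (-t - s)) (g (-t - s))) =
      (2 * Real.pi) • evalS a (iot K (r * Complex.exp (t * Complex.I))) := by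
    rw [evalS_polar hI hA hB hs hK h0 h1]
    simp only [hT, smul_add]
    rw [intervalIntegral.integral_add (i1.add i2) (i3.add i4),
      intervalIntegral.integral_add i1 i2, intervalIntegral.integral_add i3 i4, e1, e2, e3, e4]
  have hpi := Real.two_pi_pos
  have bd : ‖(2 * Real.pi) • evalS a (iot K (r * Complex.exp (t * Complex.I)))‖ ≤ 2 * Real.pi := by
    rw [← main, ← int_pk h0 h1]
    refine intervalIntegral.norm_integral_le_of_norm_le (by linarith) ?_
      ((pk_contDiff h0 h1).continuous.intervalIntegrable _ _)
    have hc1 := ae_shift hc t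
    have hc2 := ae_shift (ae_neg hc) t
    filter_upwards [hc1, hc2] with s hs1 hs2 _
    have e5 : -t - s = -(s + t) := by ring
    rw [norm_smul, Real.norm_of_nonneg (pk_nonneg h0 h1 s), add_comm t s, e5,
      alg_forward hI hJ hIJ _ _ _ _ hs1.1 hs2.1 hs1.2 hK, mul_one]
  rw [norm_smul, Real.norm_of_nonneg hpi.le] at bd
  nlinarith

end Fin



/-- Let `f ∈ H²(𝔹)` with splitting `f_I = F + G J` on the slice `L_I` (`J ⊥ I`), where the
holomorphic components `F = ∑ zⁿ Aₙ` and `G = ∑ zⁿ Bₙ` are given through their coefficients.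
Then `f` is inner iff for a.e. `z ∈ ∂𝔹_I`: `|F(z)|² + |G(z)|² = 1` and
`F(z)G(z̄) = F(z̄)G(z)` (boundary values). -/
theorem inner_iff_splitting_conditions (a : ℕ → Quaternion ℝ) (ha : MemH2 a)
    (I : Quaternion ℝ) (hI : I ∈ USphere) (J : Quaternion ℝ) (hJ : J ∈ USphere)
    (hIJ : I * J = -(J * I)) (A B : ℕ → ℂ)
    (hsplit : ∀ n : ℕ,
      a n = (((A n).re : Quaternion ℝ) + (A n).im • I) +
            (((B n).re : Quaternion ℝ) + (B n).im • I) * J) :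
    IsInnerQ a ↔
      ∀ᵐ z ∂circleM,
        ‖cBdval A z‖ ^ 2 + ‖cBdval B z‖ ^ 2 = 1 ∧
        cBdval A z * cBdval B (starRingEnd ℂ z) =
          cBdval A (starRingEnd ℂ z) * cBdval B z := by
  have hs : ∀ n, a n = Phi I J (A n) (B n) := hsplit
  have hn : ∀ n, ‖a n‖ ^ 2 = ‖A n‖ ^ 2 + ‖B n‖ ^ 2 := fun n => by
    rw [hs n, Phi_normSq hI hJ hIJ]
  have hA : CMemH2 A := by
    refine Summable.of_nonneg_of_le (fun n => by positivity) (fun n => ?_) ha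
    rw [hn n]; nlinarith [sq_nonneg ‖B n‖]
  have hB : CMemH2 B := by
    refine Summable.of_nonneg_of_le (fun n => by positivity) (fun n => ?_) ha
    rw [hn n]; nlinarith [sq_nonneg ‖A n‖]
  obtain ⟨f, -, hf, pf, lf⟩ := hardy A hA
  obtain ⟨g, -, hg, pg, lg⟩ := hardy B hB
  have lf' := ae_neg lf
  have lg' := ae_neg lg
  have hconj : ∀ t : ℝ, (starRingEnd ℂ) (Complex.exp (t * Complex.I)) =
      Complex.exp (((-t : ℝ) : ℂ) * Complex.I) := by
    intro t
    have := star_polar 1 t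
    simpa using this
  constructor
  · rintro ⟨-, -, h⟩
    apply circ_from
    filter_upwards [sigma_to h, lf, lg, lf', lg'] with t ht h1 h2 h3 h4
    rw [hconj, cBdval_eq h1, cBdval_eq h2, cBdval_eq h3, cBdval_eq h4]
    set u := Phi I J (f t) (g t) with hu
    set v := Phi I J (f (-t)) (g (-t)) with hv
    have hae : ∀ᵐ K ∂sphMeasure, K ∈ USphere → ‖Tf I K u v‖ = 1 := by
      filter_upwards [ht] with K hK hKm
      rwa [bdval_good hI hA hB hs hKm h1 h2 h3 h4] at hK
    have hIJm := IJ_mem hI hJ hIJ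
    have c1 : I * (I * J) = -((I * J) * I) := by
      nth_rewrite 2 [hIJ]
      rw [neg_mul, neg_neg, mul_assoc, ← mul_assoc I I, usphere_mul hI]
      simp
    have c2 : J * (I * J) = -((I * J) * J) := by
      rw [hIJ, mul_neg, neg_mul, neg_neg, ← mul_assoc, mul_assoc J I J, hIJ, mul_neg,
        ← mul_assoc]
    have c3 : J * I = -(I * J) := by rw [hIJ, neg_neg]
    apply alg_backward hI hJ hIJ
    · exact sph_dense_eq hI hJ hIJm hIJ c1 c2 (Tf_cont u v) hae
    · exact sph_dense_eq (usphere_neg_mem hI) hJ hIJm (by rw [neg_mul, mul_neg, hIJ])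
        (by rw [neg_mul, mul_neg, c1]) c2 (Tf_cont u v) hae
    · exact sph_dense_eq hJ hI hIJm c3 c2 c1 (Tf_cont u v) hae
    · exact sph_dense_eq hIJm hI hJ (by rw [c1, neg_neg]) (by rw [c2, neg_neg]) hIJ
        (Tf_cont u v) hae
  · intro h
    have hc : ∀ᵐ t : ℝ, ‖f t‖ ^ 2 + ‖g t‖ ^ 2 = 1 ∧ f t * g (-t) = f (-t) * g t := by
      filter_upwards [circ_to h, lf, lg, lf', lg'] with t ht h1 h2 h3 h4
      rwa [hconj, cBdval_eq h1, cBdval_eq h2, cBdval_eq h3, cBdval_eq h4] at ht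
    refine ⟨ha, ?_, ?_⟩
    · intro q hq
      obtain ⟨K, hK, z, rfl⟩ := exists_iot hI q
      have hz : ‖z‖ < 1 := by
        have : ‖iot K z‖ < 1 := hq
        rwa [iot_norm hK] at this
      rw [← Complex.norm_mul_exp_arg_mul_I z]
      exact ball_bound hI hJ hIJ hA hB hs hf hg pf pg hc hK (norm_nonneg z) hz _
    · apply sigma_from hI
      filter_upwards [hc, ae_neg hc, lf, lg, lf', lg'] with t ht ht' h1 h2 h3 h4 K hK
      rw [bdval_good hI hA hB hs hK h1 h2 h3 h4]
      exact alg_forward hI hJ hIJ _ _ _ _ ht.1 ht'.1 ht.2 hK
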